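/- Let X = {f = 0} ⊂ P³(K) be a smooth surface of degree d ≥ 3 over an algebraically closed field K of characteristic 0 or of characteristic p > d. Then there exists a homogeneous polynomial g ∈ K[w₀,w₁,w₂,w₃] of degree 11d − 24, not divisible by f, such that {P ∈ X : g(P) = 0} is exactly the set of flecnodal points of X, i.e. { P ∈ X : there exists a line L with P ∈ L and i(P, L.X) ≥ 4 }. -/

import Mathlib

open MvPolynomial

/-- The restriction of the polynomial `g` to the line through `[u]` spanned by `u` and `v`,
under the linear parametrization `t ↦ u + t • v`. -/
noncomputable def restrictLine {K : Type*} [CommSemiring K] {n : ℕ}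
    (g : MvPolynomial (Fin n) K) (u v : Fin n → K) : Polynomial K :=
  MvPolynomial.aeval (fun i => Polynomial.C (u i) + Polynomial.X * Polynomial.C (v i)) g

/-- `ordGE g u v k` means: the order of vanishing at the point `P = [u]` of the restriction
of `g` to the line spanned by `u` and `v` is at least `k` (this includes the case of the
identically vanishing restriction, i.e. order `∞`). -/
def ordGE {K : Type*} [CommSemiring K] {n : ℕ}
    (g : MvPolynomial (Fin n) K) (u v : Fin n → K) (k : ℕ) : Prop :=
  ∀ j < k, (restrictLine g u v).coeff j = 0

/-- `f` defines a smooth surface of degree `d` in `ℙ³(K)`: `f` is homogeneous of degree `d`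
and its four partial derivatives have no common zero in `ℙ³(K)`. -/
def IsSmoothSurfaceOfDegree {K : Type*} [CommSemiring K]
    (f : MvPolynomial (Fin 4) K) (d : ℕ) : Prop :=
  f.IsHomogeneous d ∧
    ∀ w : Fin 4 → K, w ≠ 0 → ∃ i : Fin 4, MvPolynomial.eval w (MvPolynomial.pderiv i f) ≠ 0

/-- A line in `ℙ³(K)` (the projectivization of a 2-dimensional linear subspace `W` of `K⁴`)
that is contained in the surface `{f = 0}`. -/
def IsLineInSurface {K : Type*} [Field K]
    (f : MvPolynomial (Fin 4) K) (W : Submodule K (Fin 4 → K)) : Prop :=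
  Module.finrank K W = 2 ∧ ∀ v ∈ W, MvPolynomial.eval v f = 0

section FlecnodalForm

/-- The trilinear form with coefficients `C`. -/
def trilin {R : Type*} [CommRing R] (C : Fin 4 → Fin 4 → Fin 4 → R) (x y z : Fin 4 → R) : R :=
  ∑ i, (∑ j, (∑ k, C i j k * z k) * y j) * x i

/-- The combination `4 ‖C‖² - 3 ‖tr C‖²` of the two quadratic invariants of a cubic form `C` with
respect to the bilinear form `M` on the dual space. -/
def flecForm {R : Type*} [CommRing R] (M : Matrix (Fin 4) (Fin 4) R)
    (C : Fin 4 → Fin 4 → Fin 4 → R) : R :=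
  4 * (∑ i, ∑ j, M i j * ∑ k, ∑ l, M k l * ∑ m, ∑ n, M m n * (C i k m * C j l n)) -
    3 * (∑ m, ∑ n, M m n *
      ((∑ i, ∑ j, M i j * C i j m) * (∑ k, ∑ l, M k l * C k l n)))

variable {R : Type*} [CommRing R]

lemma map_flecForm {S : Type*} [CommRing S] (φ : R →+* S) (M : Matrix (Fin 4) (Fin 4) R)
    (C : Fin 4 → Fin 4 → Fin 4 → R) :
    φ (flecForm M C) = flecForm (M.map φ) (fun i j k => φ (C i j k)) := by
  simp [flecForm, map_sum, map_ofNat φ 4, map_ofNat φ 3]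

lemma flecForm_smul (H : R) (M : Matrix (Fin 4) (Fin 4) R) (C : Fin 4 → Fin 4 → Fin 4 → R) :
    flecForm (H • M) C = H ^ 3 * flecForm M C := by
  have e1 : ∀ g : Fin 4 → Fin 4 → R, ∑ i, ∑ j, (H • M) i j * g i j =
      H * ∑ i, ∑ j, M i j * g i j := by
    intro g
    simp only [Matrix.smul_apply, smul_eq_mul, Finset.mul_sum, mul_assoc]
  have e2 : ∀ (c : R) (g : Fin 4 → Fin 4 → R), ∑ i, ∑ j, M i j * (c * g i j) =
      c * ∑ i, ∑ j, M i j * g i j := by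
    intro c g
    simp only [Finset.mul_sum]
    exact Finset.sum_congr rfl fun i _ => Finset.sum_congr rfl fun j _ => by ring
  unfold flecForm
  simp only [e1, e2, mul_mul_mul_comm H _ H _]
  ring

lemma sum_sum_mul_of_decomp {ι κ : Type*} [Fintype ι] [Fintype κ]
    (M : Matrix (Fin 4) (Fin 4) R) (x y : κ → Fin 4 → R)
    (hM : ∀ i j, M i j = ∑ a, x a i * y a j) (p q : ι → Fin 4 → R) :
    ∑ i, ∑ j, M i j * ∑ c, p c i * q c j =
      ∑ c, ∑ a, (∑ i, p c i * x a i) * ∑ j, q c j * y a j := by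
  simp only [hM, Finset.sum_mul_sum]
  calc _ = ∑ i, ∑ j, ∑ c, ∑ a, p c i * x a i * (q c j * y a j) := by
        refine Finset.sum_congr rfl fun i _ => Finset.sum_congr rfl fun j _ => ?_
        rw [Finset.sum_comm]
        exact Finset.sum_congr rfl fun i _ => Finset.sum_congr rfl fun j _ => by ring
    _ = ∑ i, ∑ c, ∑ j, ∑ a, p c i * x a i * (q c j * y a j) :=
        Finset.sum_congr rfl fun i _ => Finset.sum_comm
    _ = ∑ c, ∑ i, ∑ j, ∑ a, p c i * x a i * (q c j * y a j) := Finset.sum_comm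
    _ = ∑ c, ∑ i, ∑ a, ∑ j, p c i * x a i * (q c j * y a j) :=
        Finset.sum_congr rfl fun i _ => Finset.sum_congr rfl fun j _ => Finset.sum_comm
    _ = _ := Finset.sum_congr rfl fun i _ => Finset.sum_comm

lemma flecForm_of_decomp {κ : Type*} [Fintype κ]
    (M : Matrix (Fin 4) (Fin 4) R) (C : Fin 4 → Fin 4 → Fin 4 → R) (x y : κ → Fin 4 → R)
    (hM : ∀ i j, M i j = ∑ a, x a i * y a j) :
    flecForm M C =
      4 * (∑ a, ∑ b, ∑ c, trilin C (x a) (x b) (x c) * trilin C (y a) (y b) (y c)) -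
      3 * (∑ c, (∑ a, trilin C (x a) (y a) (x c)) * (∑ b, trilin C (x b) (y b) (y c))) := by
  have k1 : ∀ p q : Fin 4 → R, ∑ i, ∑ j, M i j * (p i * q j) =
      ∑ a, (∑ i, p i * x a i) * ∑ j, q j * y a j := by
    intro p q
    simpa using sum_sum_mul_of_decomp (ι := Unit) M x y hM (fun _ => p) (fun _ => q)
  have tr : ∀ z : Fin 4 → R, ∑ m, (∑ i, ∑ j, M i j * C i j m) * z m =
      ∑ a, trilin C (x a) (y a) z := by
    intro z
    have : ∑ m, (∑ i, ∑ j, M i j * C i j m) * z m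
        = ∑ i, ∑ j, M i j * ∑ m, C i j m * z m := by
      simp only [Finset.sum_mul, Finset.mul_sum, mul_assoc]
      rw [Finset.sum_comm]
      exact Finset.sum_congr rfl fun i _ => Finset.sum_comm
    rw [this]
    simp only [hM, trilin, Finset.sum_mul]
    calc _ = ∑ i, ∑ a, ∑ j, x a i * y a j * ∑ m, C i j m * z m :=
          Finset.sum_congr rfl fun i _ => Finset.sum_comm
      _ = ∑ a, ∑ i, ∑ j, x a i * y a j * ∑ m, C i j m * z m := Finset.sum_comm
      _ = _ := by
          refine Finset.sum_congr rfl fun a _ => Finset.sum_congr rfl fun i _ =>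
            Finset.sum_congr rfl fun j _ => ?_
          rw [Finset.mul_sum]
          exact Finset.sum_congr rfl fun k _ => by ring
  unfold flecForm
  congr 2
  · simp only [k1]
    simp only [sum_sum_mul_of_decomp M x y hM]
    have k2 : ∀ p q : κ → κ → Fin 4 → R,
        ∑ i, ∑ j, M i j * ∑ c, ∑ b, p c b i * q c b j =
        ∑ a, ∑ b, ∑ c, (∑ i, p c b i * x a i) * ∑ j, q c b j * y a j := by
      intro p q
      have := sum_sum_mul_of_decomp (ι := κ × κ) M x y hM (fun c => p c.1 c.2)
        (fun c => q c.1 c.2)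
      simp only [Fintype.sum_prod_type] at this
      rw [this]
      refine (Finset.sum_congr rfl fun c _ => Finset.sum_comm).trans ?_
      refine Finset.sum_comm.trans ?_
      exact Finset.sum_congr rfl fun c _ => Finset.sum_comm
    rw [k2]
    rfl
  · rw [k1]
    simp only [tr]

lemma trilin_add_right (C : Fin 4 → Fin 4 → Fin 4 → R) (x y z z' : Fin 4 → R) :
    trilin C x y (z + z') = trilin C x y z + trilin C x y z' := by
  simp only [trilin, Pi.add_apply, mul_add, add_mul, Finset.sum_add_distrib]

lemma trilin_smul_right (C : Fin 4 → Fin 4 → Fin 4 → R) (a : R) (x y z : Fin 4 → R) :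
    trilin C x y (a • z) = a * trilin C x y z := by
  simp only [trilin, Pi.smul_apply, smul_eq_mul, Finset.mul_sum, Finset.sum_mul]
  exact Finset.sum_congr rfl fun i _ => Finset.sum_congr rfl fun j _ =>
    Finset.sum_congr rfl fun k _ => by ring

lemma trilin_left_comm {C : Fin 4 → Fin 4 → Fin 4 → R} (h : ∀ i j k, C i j k = C j i k)
    (x y z : Fin 4 → R) : trilin C x y z = trilin C y x z := by
  simp only [trilin, Finset.sum_mul]
  rw [Finset.sum_comm]
  refine Finset.sum_congr rfl fun i _ => Finset.sum_congr rfl fun j _ =>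
    Finset.sum_congr rfl fun k _ => ?_
  rw [h]
  ring

lemma trilin_right_comm {C : Fin 4 → Fin 4 → Fin 4 → R} (h : ∀ i j k, C i j k = C i k j)
    (x y z : Fin 4 → R) : trilin C x y z = trilin C x z y := by
  simp only [trilin, Finset.sum_mul]
  refine Finset.sum_congr rfl fun i _ => ?_
  rw [Finset.sum_comm]
  refine Finset.sum_congr rfl fun j _ => Finset.sum_congr rfl fun k _ => ?_
  rw [h]
  ring

open Matrix

lemma dotProduct_mulVec_symm {A : Matrix (Fin 4) (Fin 4) R} (hA : A.IsSymm) (x y : Fin 4 → R) :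
    x ⬝ᵥ A *ᵥ y = y ⬝ᵥ A *ᵥ x := by
  rw [dotProduct_mulVec, ← mulVec_transpose, hA.eq, dotProduct_comm]

variable {F : Type*} [Field F]

lemma exists_dotProduct_mulVec_eq_one {A : Matrix (Fin 4) (Fin 4) F} (hA : A.IsSymm)
    {z : Fin 4 → F} (hz : A *ᵥ z ≠ 0) : ∃ w, z ⬝ᵥ A *ᵥ w = 1 := by
  obtain ⟨i, hi⟩ := Function.ne_iff.mp hz
  refine ⟨((A *ᵥ z) i)⁻¹ • Pi.single i 1, ?_⟩
  rw [dotProduct_mulVec_symm hA, smul_dotProduct, single_one_dotProduct, smul_eq_mul,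
    inv_mul_cancel₀ hi]

lemma exists_ne_zero_forall_dotProduct_eq_zero {m : ℕ} (hm : m < 4) (r : Fin m → Fin 4 → F) :
    ∃ p : Fin 4 → F, p ≠ 0 ∧ ∀ i, r i ⬝ᵥ p = 0 := by
  have h := LinearMap.ker_ne_bot_of_finrank_lt (f := (Matrix.of r).mulVecLin) (by simpa using hm)
  obtain ⟨p, hp, hp0⟩ := (Submodule.ne_bot_iff _).mp h
  refine ⟨p, hp0, fun i => ?_⟩
  exact congrFun (LinearMap.mem_ker.mp hp) i

/-- `P` is a basis in which the quadratic form `A` is a sum of two hyperbolic planes spanned by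
`P 0, P 1` and by `P 2, P 3`. -/
structure IsHyperbolicBasis (A : Matrix (Fin 4) (Fin 4) F) (P : Fin 4 → Fin 4 → F) : Prop where
  gram : ∀ a b, P a ⬝ᵥ A *ᵥ P b = !![0, 1, 0, 0; 1, 0, 0, 0; 0, 0, 0, 1; 0, 0, 1, 0] a b

lemma exists_isHyperbolicBasis (h2 : (2 : F) ≠ 0) (hsq : ∀ x : F, ∃ z, x = z * z)
    {A : Matrix (Fin 4) (Fin 4) F} (hA : A.IsSymm) (hdet : A.det ≠ 0) {u : Fin 4 → F}
    (hu : u ≠ 0) (huu : u ⬝ᵥ A *ᵥ u = 0) :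
    ∃ P, IsHyperbolicBasis A P ∧ P 0 = u := by
  have hinj : ∀ z, z ≠ 0 → A *ᵥ z ≠ 0 := fun z hz h =>
    hz (Matrix.eq_zero_of_mulVec_eq_zero hdet h)
  have hs := dotProduct_mulVec_symm hA
  obtain ⟨w, hw⟩ := exists_dotProduct_mulVec_eq_one hA (hinj u hu)
  obtain ⟨u', hu', huu', hu'u'⟩ : ∃ u', u ⬝ᵥ A *ᵥ u' = 1 ∧ u' ⬝ᵥ A *ᵥ u = 1 ∧
      u' ⬝ᵥ A *ᵥ u' = 0 := by
    have hw' := hw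
    rw [hs] at hw'
    refine ⟨w - ((w ⬝ᵥ A *ᵥ w) / 2) • u, ?_, ?_, ?_⟩ <;>
    · simp only [mulVec_sub, mulVec_smul, dotProduct_sub, dotProduct_smul, sub_dotProduct,
        smul_dotProduct, huu, hw, hw', smul_eq_mul]
      field_simp
      try ring
  obtain ⟨e, he0, hue, hu'e, hee⟩ : ∃ e, e ≠ 0 ∧ u ⬝ᵥ A *ᵥ e = 0 ∧ u' ⬝ᵥ A *ᵥ e = 0 ∧
      e ⬝ᵥ A *ᵥ e = 0 := by
    obtain ⟨p, hp0, hp⟩ := exists_ne_zero_forall_dotProduct_eq_zero (by norm_num : 2 < 4)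
      ![A *ᵥ u, A *ᵥ u']
    have h1 := hp 0
    have h2 := hp 1
    simp only [cons_val_zero, cons_val_one, dotProduct_comm _ p] at h1 h2
    rw [hs] at h1 h2
    by_cases hpp : p ⬝ᵥ A *ᵥ p = 0
    · exact ⟨p, hp0, h1, h2, hpp⟩
    obtain ⟨q, hq0, hq⟩ := exists_ne_zero_forall_dotProduct_eq_zero (by norm_num : 3 < 4)
      ![A *ᵥ u, A *ᵥ u', A *ᵥ p]
    have h3 := hq 0
    have h4 := hq 1
    have h5 := hq 2
    simp only [cons_val, dotProduct_comm _ q] at h3 h4 h5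
    have h6 := h5
    rw [hs] at h3 h4 h6
    obtain ⟨s, hs'⟩ := hsq (-(q ⬝ᵥ A *ᵥ q) / (p ⬝ᵥ A *ᵥ p))
    refine ⟨s • p + q, fun h0 => ?_, ?_, ?_, ?_⟩
    · have : p ⬝ᵥ A *ᵥ (s • p + q) = 0 := by simp [h0]
      simp only [mulVec_add, mulVec_smul, dotProduct_add, dotProduct_smul, h6, smul_eq_mul,
        add_zero, mul_eq_zero, hpp, or_false] at this
      simp [this] at h0
      exact hq0 h0
    · simp [mulVec_add, mulVec_smul, h1, h3]
    · simp [mulVec_add, mulVec_smul, h2, h4]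
    · simp only [mulVec_add, mulVec_smul, dotProduct_add, dotProduct_smul, add_dotProduct,
        smul_dotProduct, h5, h6, smul_eq_mul]
      field_simp at hs'
      linear_combination -hs'
  have heu := hue
  have heu' := hu'e
  rw [hs] at heu heu'
  obtain ⟨w, hw⟩ := exists_dotProduct_mulVec_eq_one hA (hinj e he0)
  obtain ⟨e', he, he', h1, h2, h3, h4, h5⟩ : ∃ e', e ⬝ᵥ A *ᵥ e' = 1 ∧ e' ⬝ᵥ A *ᵥ e = 1 ∧
      e' ⬝ᵥ A *ᵥ e' = 0 ∧ u ⬝ᵥ A *ᵥ e' = 0 ∧ u' ⬝ᵥ A *ᵥ e' = 0 ∧ e' ⬝ᵥ A *ᵥ u = 0 ∧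
      e' ⬝ᵥ A *ᵥ u' = 0 := by
    have hw' := hw
    rw [hs] at hw'
    obtain ⟨w₁, h1, h2, h3, h4, h5, h6⟩ : ∃ w₁, e ⬝ᵥ A *ᵥ w₁ = 1 ∧ w₁ ⬝ᵥ A *ᵥ e = 1 ∧
      u ⬝ᵥ A *ᵥ w₁ = 0 ∧ u' ⬝ᵥ A *ᵥ w₁ = 0 ∧ w₁ ⬝ᵥ A *ᵥ u = 0 ∧ w₁ ⬝ᵥ A *ᵥ u' = 0 := by
      refine ⟨w - (u' ⬝ᵥ A *ᵥ w) • u - (u ⬝ᵥ A *ᵥ w) • u', ?_, ?_, ?_, ?_, ?_, ?_⟩ <;>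
      simp [mulVec_sub, mulVec_smul, huu, hu', hu'u', huu', hw, hw', hue, hu'e, heu, heu',
        hs w u, hs w u']
    refine ⟨w₁ - ((w₁ ⬝ᵥ A *ᵥ w₁) / 2) • e, ?_, ?_, ?_, ?_, ?_, ?_, ?_⟩ <;>
    · simp only [mulVec_sub, mulVec_smul, dotProduct_sub, dotProduct_smul, sub_dotProduct,
        smul_dotProduct, h1, h2, h3, h4, h5, h6, hee, hue, hu'e, heu, heu', smul_eq_mul]
      field_simp
      try ring
  refine ⟨![u, u', e, e'], ⟨fun a b => ?_⟩, rfl⟩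
  fin_cases a <;> fin_cases b <;>
    simp [huu, hu', hu'u', huu', hue, hu'e, heu, heu', hee, he, he', h1, h2, h3, h4, h5]

namespace IsHyperbolicBasis

variable {A : Matrix (Fin 4) (Fin 4) F} {P : Fin 4 → Fin 4 → F}

lemma mul_mul_transpose_eq (hP : IsHyperbolicBasis A P) :
    Matrix.of P * A * (Matrix.of P)ᵀ = !![0, 1, 0, 0; 1, 0, 0, 0; 0, 0, 0, 1; 0, 0, 1, 0] := by
  ext a b
  rw [← hP.gram a b, Matrix.mul_assoc, Matrix.mul_apply]
  simp only [dotProduct, mulVec, Matrix.mul_apply, transpose_apply, of_apply]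

lemma inv_mul_eq_one (hP : IsHyperbolicBasis A P) :
    ((Matrix.of P)ᵀ * !![0, 1, 0, 0; 1, 0, 0, 0; 0, 0, 0, 1; 0, 0, 1, 0] * Matrix.of P) * A
      = 1 := by
  have hJ : (!![0, 1, 0, 0; 1, 0, 0, 0; 0, 0, 0, 1; 0, 0, 1, 0] : Matrix (Fin 4) (Fin 4) F) *
      !![0, 1, 0, 0; 1, 0, 0, 0; 0, 0, 0, 1; 0, 0, 1, 0] = 1 := by
    ext i j
    fin_cases i <;> fin_cases j <;> simp [Matrix.mul_apply, Fin.sum_univ_four]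
  have h1 := congrArg (fun M => !![0, 1, 0, 0; 1, 0, 0, 0; 0, 0, 0, 1; 0, 0, 1, 0] * M)
    hP.mul_mul_transpose_eq
  simp only [hJ] at h1
  rw [← Matrix.mul_assoc, _root_.mul_eq_one_comm] at h1
  simpa only [Matrix.mul_assoc] using h1

lemma eq_sum (hP : IsHyperbolicBasis A P) (x : Fin 4 → F) :
    x = (P 1 ⬝ᵥ A *ᵥ x) • P 0 + (P 0 ⬝ᵥ A *ᵥ x) • P 1 + (P 3 ⬝ᵥ A *ᵥ x) • P 2 +
      (P 2 ⬝ᵥ A *ᵥ x) • P 3 := by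
  have h := congrArg (fun M => M *ᵥ x) hP.inv_mul_eq_one
  simp only [one_mulVec, ← mulVec_mulVec] at h
  conv_lhs => rw [← h]
  ext i
  simp only [mulVec, dotProduct, Fin.sum_univ_four, transpose_apply, of_apply, Pi.add_apply,
    Pi.smul_apply, smul_eq_mul, cons_val', cons_val_fin_one, cons_val]
  ring

lemma adjugate_apply (hP : IsHyperbolicBasis A P) (i j : Fin 4) :
    A.adjugate i j = (A.det • Matrix.of fun i j =>
      ∑ a, P a i * (![P 1, P 0, P 3, P 2] : Fin 4 → Fin 4 → F) a j) i j := by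
  have h1 : A.adjugate = A.det • ((Matrix.of P)ᵀ *
      !![0, 1, 0, 0; 1, 0, 0, 0; 0, 0, 0, 1; 0, 0, 1, 0] * Matrix.of P) := by
    calc A.adjugate = ((Matrix.of P)ᵀ *
        !![0, 1, 0, 0; 1, 0, 0, 0; 0, 0, 0, 1; 0, 0, 1, 0] * Matrix.of P) * A * A.adjugate := by
          rw [hP.inv_mul_eq_one, Matrix.one_mul]
      _ = _ := by
          rw [Matrix.mul_assoc, Matrix.mul_adjugate, Matrix.mul_smul, Matrix.mul_one]
  rw [h1]
  simp [Matrix.mul_apply, Fin.sum_univ_four]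
  ring_nf
  simp

lemma flecForm_adjugate (hP : IsHyperbolicBasis A P) {C : Fin 4 → Fin 4 → Fin 4 → F}
    (hC₁ : ∀ i j k, C i j k = C j i k) (hC₂ : ∀ i j k, C i j k = C i k j) {c : F}
    (hc : ∀ y z, trilin C (P 0) y z = c * (y ⬝ᵥ A *ᵥ z)) :
    flecForm A.adjugate C =
      A.det ^ 3 * (8 * (trilin C (P 2) (P 2) (P 2) * trilin C (P 3) (P 3) (P 3))) := by
  have h : A.adjugate = A.det • Matrix.of fun i j =>
      ∑ a, P a i * (![P 1, P 0, P 3, P 2] : Fin 4 → Fin 4 → F) a j :=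
    Matrix.ext hP.adjugate_apply
  rw [h, flecForm_smul, flecForm_of_decomp (Matrix.of fun i j =>
    ∑ a, P a i * (![P 1, P 0, P 3, P 2] : Fin 4 → Fin 4 → F) a j) C P _ (fun _ _ => rfl)]
  congr 1
  have hl := fun a b z => trilin_left_comm hC₁ (P a) (P b) z
  have hr := fun a b z => trilin_right_comm hC₂ z (P a) (P b)
  have hg : ∀ b d, trilin C (P 0) (P b) (P d) = c *
      !![0, 1, 0, 0; 1, 0, 0, 0; 0, 0, 0, 1; 0, 0, 1, 0] b d := fun b d => by rw [hc, hP.gram]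
  simp only [Fin.sum_univ_four, cons_val_zero, cons_val_one, cons_val]
  simp only [hl 1 0, hl 2 0, hl 3 0, hl 2 1, hl 3 1, hl 3 2, hr 1 0, hr 2 0, hr 3 0, hr 2 1,
    hr 3 1, hr 3 2]
  simp only [hg]
  simp
  ring

end IsHyperbolicBasis

lemma eq_smul_of_forall_dotProduct_eq_zero {r : Fin 3 → Fin 4 → F} (hr : LinearIndependent F r)
    {a b : Fin 4 → F} (ha : ∀ i, r i ⬝ᵥ a = 0) (hb : ∀ i, r i ⬝ᵥ b = 0) (hb0 : b ≠ 0) :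
    ∃ c : F, a = c • b := by
  have h1 : Module.finrank F (LinearMap.ker (Matrix.of r).mulVecLin) = 1 := by
    have h := LinearMap.finrank_range_add_finrank_ker (Matrix.of r).mulVecLin
    have h' : (Matrix.of r).rank = 3 := by
      simpa using LinearIndependent.rank_matrix (M := Matrix.of r) hr
    rw [Matrix.rank] at h'
    simp [h'] at h
    omega
  have hb' : (⟨b, LinearMap.mem_ker.mpr (funext hb)⟩ :
      LinearMap.ker (Matrix.of r).mulVecLin) ≠ 0 := fun h => hb0 (congrArg Subtype.val h)
  obtain ⟨c, hc⟩ := exists_smul_eq_of_finrank_eq_one h1 hb'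
    ⟨a, LinearMap.mem_ker.mpr (funext ha)⟩
  exact ⟨c, (congrArg Subtype.val hc).symm⟩

lemma exists_ker_eq_span_of_adjugate_ne_zero {A : Matrix (Fin 4) (Fin 4) F} (hA : A.IsSymm)
    (hdet : A.det = 0) (hadj : A.adjugate ≠ 0) :
    ∃ (k : Fin 4 → F) (c : F), k ≠ 0 ∧ c ≠ 0 ∧ A *ᵥ k = 0 ∧ (∀ x, A *ᵥ x = 0 → ∃ s : F, x = s • k) ∧
      A.adjugate = c • Matrix.of fun i j => k i * k j := by
  obtain ⟨i, j, hij⟩ : ∃ i j, A.adjugate i j ≠ 0 := by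
    by_contra! h
    exact hadj (Matrix.ext h)
  have hcol : ∀ b, A *ᵥ (fun a => A.adjugate a b) = 0 := by
    intro b
    have h := Matrix.mul_adjugate A
    rw [hdet, zero_smul] at h
    exact funext fun a => congrFun (congrFun h a) b
  have hinj : ∀ x, A *ᵥ x = 0 → x i = 0 → x = 0 := by
    intro x hx hxi
    rw [Matrix.adjugate_apply] at hij
    refine Matrix.eq_zero_of_mulVec_eq_zero hij ?_
    ext l
    by_cases hl : l = j
    · subst hl
      simp [mulVec, hxi]
    · have := congrFun hx l
      simpa [mulVec, Matrix.updateRow_ne hl] using this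
  set k : Fin 4 → F := fun a => A.adjugate a j with hk
  have hki : k i ≠ 0 := hij
  have hspan : ∀ x, A *ᵥ x = 0 → x = (x i / k i) • k := by
    intro x hx
    have := hinj (x - (x i / k i) • k) (by simp [mulVec_sub, mulVec_smul, hx, hk, hcol])
      (by simp [hki])
    exact sub_eq_zero.mp this
  have hM : ∀ a b, A.adjugate a b = A.adjugate i b / k i * k a := fun a b =>
    congrFun (hspan _ (hcol b)) a
  have hs : ∀ a b, A.adjugate a b = A.adjugate b a := fun a b => hA.adjugate.apply b a
  refine ⟨k, A.adjugate i i / k i / k i, fun h => hki (by rw [h]; rfl), ?_, hcol j,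
    fun x hx => ⟨_, hspan x hx⟩, ?_⟩
  · intro h
    have h0 : A.adjugate i i = 0 := by simpa [hki] using h
    apply hki
    rw [hk]
    simp only
    rw [hs, hM, h0] 
    simp
  · ext a b
    rw [hM a b, hs i b, hM b i]
    simp only [Matrix.smul_apply, of_apply, smul_eq_mul]
    ring

lemma exists_linearIndependent_ker_of_adjugate_eq_zero {A : Matrix (Fin 4) (Fin 4) F}
    (hA : A.IsSymm) (hadj : A.adjugate = 0) :
    ∃ k k' : Fin 4 → F, LinearIndependent F ![k, k'] ∧ A *ᵥ k = 0 ∧ A *ᵥ k' = 0 := by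
  have hdet : A.det = 0 := by
    have h := Matrix.mul_adjugate A
    rw [hadj, Matrix.mul_zero] at h
    simpa using (congrFun (congrFun h 0) 0).symm
  obtain ⟨k, hk0, hk⟩ := Matrix.exists_mulVec_eq_zero_iff.mpr hdet
  obtain ⟨i, hi⟩ := Function.ne_iff.mp hk0
  have h := congrFun (congrFun hadj i) i
  rw [Matrix.adjugate_apply] at h
  obtain ⟨x, hx0, hx⟩ := Matrix.exists_mulVec_eq_zero_iff.mpr h
  have hxi : x i = 0 := by simpa [mulVec] using congrFun hx i
  have hAx : ∀ l, l ≠ i → (A *ᵥ x) l = 0 := fun l hl => by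
    simpa [mulVec, Matrix.updateRow_ne hl] using congrFun hx l
  have hkx : k ⬝ᵥ A *ᵥ x = 0 := by rw [dotProduct_mulVec_symm hA, hk, dotProduct_zero]
  rw [dotProduct, Finset.sum_eq_single i (fun l _ hl => by rw [hAx l hl, mul_zero])
    (by simp)] at hkx
  refine ⟨k, x, ?_, hk, ?_⟩
  · rw [LinearIndependent.pair_iff]
    intro s t hst
    have hs : s = 0 := by
      have := congrFun hst i
      simpa [hxi, show k i ≠ 0 from hi] using this
    subst hs
    simpa [hx0] using hst
  · ext l
    by_cases hl : l = i
    · subst hl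
      exact (mul_eq_zero.mp hkx).resolve_left hi
    · exact hAx l hl

lemma trilin_self_comb {C : Fin 4 → Fin 4 → Fin 4 → R} (hC₁ : ∀ i j k, C i j k = C j i k)
    (hC₂ : ∀ i j k, C i j k = C i k j) (a b : R) (x y : Fin 4 → R) :
    trilin C (a • x + b • y) (a • x + b • y) (a • x + b • y) = a ^ 3 * trilin C x x x +
      3 * a ^ 2 * b * trilin C x x y + 3 * a * b ^ 2 * trilin C x y y +
      b ^ 3 * trilin C y y y := by
  have hl := fun x y z => trilin_left_comm hC₁ x y z
  have hr := fun x y z => trilin_right_comm hC₂ x y z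
  have e : ∀ p q, trilin C p q (a • x + b • y) = a * trilin C p q x + b * trilin C p q y := by
    intro p q
    rw [trilin_add_right, trilin_smul_right, trilin_smul_right]
  have e1 : ∀ p q, trilin C p (a • x + b • y) q = a * trilin C p x q + b * trilin C p y q := by
    intro p q
    rw [hr, e, hr p q x, hr p q y]
  have e2 : ∀ p q, trilin C (a • x + b • y) p q = a * trilin C x p q + b * trilin C y p q := by
    intro p q
    rw [hl, e1, hl p x, hl p y]
  simp only [e, e1, e2]
  rw [hr x y x, hl y x x, hr x y x, hr y y x, hl y x y]
  ring

lemma linearIndependent_of_mulVec_eq_zero {A : Matrix (Fin 4) (Fin 4) F} {u v : Fin 4 → F}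
    (hu : A *ᵥ u ≠ 0) (hv0 : v ≠ 0) (hv : A *ᵥ v = 0) : LinearIndependent F ![u, v] := by
  rw [LinearIndependent.pair_iff]
  intro s t hst
  have h := congrArg (fun x => A *ᵥ x) hst
  simp only [mulVec_add, mulVec_smul, hv, smul_zero, add_zero, mulVec_zero, smul_eq_zero, hu,
    or_false] at h
  subst h
  simpa [hv0] using hst

lemma linearIndependent_triple_of_mulVec_eq_zero {A : Matrix (Fin 4) (Fin 4) F}
    {u k k' : Fin 4 → F} (hu : A *ᵥ u ≠ 0) (h : LinearIndependent F ![k, k'])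
    (hk : A *ᵥ k = 0) (hk' : A *ᵥ k' = 0) : LinearIndependent F ![u, k, k'] := by
  rw [Fintype.linearIndependent_iff]
  intro g hg
  simp only [Fin.sum_univ_three, cons_val] at hg
  have h0 := congrArg (fun x => A *ᵥ x) hg
  simp only [mulVec_add, mulVec_smul, hk, hk', smul_zero, add_zero, mulVec_zero, smul_eq_zero, hu,
    or_false] at h0
  rw [h0, zero_smul, zero_add] at hg
  have := LinearIndependent.pair_iff.mp h _ _ hg
  intro i
  fin_cases i
  exacts [h0, this.1, this.2]

lemma dotProduct_mulVec_self_eq_zero_of_adjugate_eq_zero {A : Matrix (Fin 4) (Fin 4) F}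
    (hA : A.IsSymm) (hadj : A.adjugate = 0) {u v : Fin 4 → F} (hu : A *ᵥ u ≠ 0)
    (huu : u ⬝ᵥ A *ᵥ u = 0) (huv : u ⬝ᵥ A *ᵥ v = 0) : v ⬝ᵥ A *ᵥ v = 0 := by
  have hs := dotProduct_mulVec_symm hA
  obtain ⟨k, k', hkk, hk, hk'⟩ := exists_linearIndependent_ker_of_adjugate_eq_zero hA hadj
  obtain ⟨c, hc⟩ := eq_smul_of_forall_dotProduct_eq_zero
    (linearIndependent_triple_of_mulVec_eq_zero hu hkk hk hk') (a := A *ᵥ v) (b := A *ᵥ u)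
    (by
      intro i
      fin_cases i
      · exact huv
      · simp [hs k, hk]
      · simp [hs k', hk'])
    (by
      intro i
      fin_cases i
      · exact huu
      · simp [hs k, hk]
      · simp [hs k', hk']) hu
  rw [hc, dotProduct_smul, hs, huv, smul_zero]

/-- `v` spans together with `u` a line which meets to order at least four the surface with second
and third derivatives `A` and `C` at `u`. -/
structure IsFlecnodalDirection (A : Matrix (Fin 4) (Fin 4) F) (C : Fin 4 → Fin 4 → Fin 4 → F)
    (u v : Fin 4 → F) : Prop where
  linearIndependent : LinearIndependent F ![u, v]
  tangent : u ⬝ᵥ A *ᵥ v = 0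
  asymptotic : v ⬝ᵥ A *ᵥ v = 0
  cubic : trilin C v v v = 0

lemma flecForm_adjugate_of_ker {A : Matrix (Fin 4) (Fin 4) F} {C : Fin 4 → Fin 4 → Fin 4 → F}
    {k : Fin 4 → F} {c : F} (h : A.adjugate = c • Matrix.of fun i j => k i * k j) :
    flecForm A.adjugate C = c ^ 3 * trilin C k k k ^ 2 := by
  rw [h, flecForm_smul, flecForm_of_decomp (κ := Unit) (Matrix.of fun i j => k i * k j) C
    (fun _ => k) (fun _ => k) (fun _ _ => by simp)]
  simp
  left
  ring

lemma IsHyperbolicBasis.eq_comb {A : Matrix (Fin 4) (Fin 4) F} {P : Fin 4 → Fin 4 → F}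
    (hP : IsHyperbolicBasis A P) {x : Fin 4 → F} (hx : P 0 ⬝ᵥ A *ᵥ x = 0)
    (h : P 2 ⬝ᵥ A *ᵥ x = 0 ∨ P 3 ⬝ᵥ A *ᵥ x = 0) :
    ∃ a b : F, x = a • P 0 + b • P 2 ∨ x = a • P 0 + b • P 3 := by
  have e := hP.eq_sum x
  rw [hx, zero_smul, add_zero] at e
  rcases h with h | h
  · rw [h, zero_smul, add_zero] at e
    exact ⟨_, _, Or.inl e⟩
  · rw [h, zero_smul, add_zero] at e
    exact ⟨_, _, Or.inr e⟩

lemma IsHyperbolicBasis.isFlecnodalDirection {A : Matrix (Fin 4) (Fin 4) F}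
    {P : Fin 4 → Fin 4 → F} (hP : IsHyperbolicBasis A P) {C : Fin 4 → Fin 4 → Fin 4 → F}
    {i : Fin 4} (hi : i = 2 ∨ i = 3) (hc : trilin C (P i) (P i) (P i) = 0) :
    IsFlecnodalDirection A C (P 0) (P i) := by
  refine ⟨?_, ?_, ?_, hc⟩
  · rw [LinearIndependent.pair_iff]
    intro s t hst
    constructor
    · have := congrArg (fun x => P 1 ⬝ᵥ A *ᵥ x) hst
      rcases hi with rfl | rfl <;> simpa [mulVec_add, mulVec_smul, hP.gram] using this
    · rcases hi with rfl | rfl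
      · have := congrArg (fun x => P 3 ⬝ᵥ A *ᵥ x) hst
        simpa [mulVec_add, mulVec_smul, hP.gram] using this
      · have := congrArg (fun x => P 2 ⬝ᵥ A *ᵥ x) hst
        simpa [mulVec_add, mulVec_smul, hP.gram] using this
  · rcases hi with rfl | rfl <;> simp [hP.gram]
  · rcases hi with rfl | rfl <;> simp [hP.gram]

section

variable {A : Matrix (Fin 4) (Fin 4) F} {C : Fin 4 → Fin 4 → Fin 4 → F} {u : Fin 4 → F}

lemma trilin_self_comb_of_polar (hC₁ : ∀ i j k, C i j k = C j i k)
    (hC₂ : ∀ i j k, C i j k = C i k j) {c : F}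
    (hc : ∀ y z, trilin C u y z = c * (y ⬝ᵥ A *ᵥ z)) (huu : u ⬝ᵥ A *ᵥ u = 0) {v : Fin 4 → F}
    (huv : u ⬝ᵥ A *ᵥ v = 0) (hvv : v ⬝ᵥ A *ᵥ v = 0) (a b : F) :
    trilin C (a • u + b • v) (a • u + b • v) (a • u + b • v) = b ^ 3 * trilin C v v v := by
  rw [trilin_self_comb hC₁ hC₂, hc, hc, hc, huu, huv, hvv]
  ring

lemma trilin_eq_zero_of_isFlecnodalDirection_comb (hC₁ : ∀ i j k, C i j k = C j i k)
    (hC₂ : ∀ i j k, C i j k = C i k j) {c : F}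
    (hc : ∀ y z, trilin C u y z = c * (y ⬝ᵥ A *ᵥ z)) (huu : u ⬝ᵥ A *ᵥ u = 0) {v : Fin 4 → F}
    (huv : u ⬝ᵥ A *ᵥ v = 0) (hvv : v ⬝ᵥ A *ᵥ v = 0) {a b : F}
    (h : IsFlecnodalDirection A C u (a • u + b • v)) : trilin C v v v = 0 := by
  have h0 := h.cubic
  rw [trilin_self_comb_of_polar hC₁ hC₂ hc huu huv hvv] at h0
  refine (mul_eq_zero.mp h0).resolve_left fun hb => ?_
  have hb := pow_eq_zero_iff (three_ne_zero) |>.mp hb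
  have := LinearIndependent.pair_iff.mp h.linearIndependent (-a) 1 (by simp [hb])
  exact one_ne_zero this.2

theorem flecForm_adjugate_eq_zero_iff_of_det_ne_zero (h2 : (2 : F) ≠ 0)
    (hsq : ∀ x : F, ∃ z, x = z * z)
    (hA : A.IsSymm) (hC₁ : ∀ i j k, C i j k = C j i k) (hC₂ : ∀ i j k, C i j k = C i k j)
    {c : F} (hc : ∀ y z, trilin C u y z = c * (y ⬝ᵥ A *ᵥ z)) (hu : u ≠ 0)
    (huu : u ⬝ᵥ A *ᵥ u = 0) (hdet : A.det ≠ 0) :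
    flecForm A.adjugate C = 0 ↔ ∃ v, IsFlecnodalDirection A C u v := by
  obtain ⟨P, hP, rfl⟩ := exists_isHyperbolicBasis h2 hsq hA hdet hu huu
  have h8 : (8 : F) ≠ 0 := by
    rw [show (8 : F) = 2 ^ 3 by norm_num]
    exact pow_ne_zero _ h2
  rw [hP.flecForm_adjugate hC₁ hC₂ hc]
  simp only [mul_eq_zero, pow_eq_zero_iff (three_ne_zero), hdet, h8, false_or]
  constructor
  · rintro (h | h)
    · exact ⟨_, hP.isFlecnodalDirection (Or.inl rfl) h⟩
    · exact ⟨_, hP.isFlecnodalDirection (Or.inr rfl) h⟩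
  · rintro ⟨v, hv⟩
    have h23 : P 2 ⬝ᵥ A *ᵥ v = 0 ∨ P 3 ⬝ᵥ A *ᵥ v = 0 := by
      have h := hv.asymptotic
      have e := hP.eq_sum v
      rw [hv.tangent, zero_smul, add_zero] at e
      have e2 := dotProduct_mulVec_symm hA v (P 2)
      have e3 := dotProduct_mulVec_symm hA v (P 3)
      have e0 := dotProduct_mulVec_symm hA v (P 0)
      rw [hv.tangent] at e0
      generalize hβ : P 2 ⬝ᵥ A *ᵥ v = β at *
      generalize hγ : P 3 ⬝ᵥ A *ᵥ v = γ at *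
      generalize P 1 ⬝ᵥ A *ᵥ v = α at *
      have h' : v ⬝ᵥ A *ᵥ (α • P 0 + γ • P 2 + β • P 3) = 0 := by rw [← e]; exact h
      simp only [mulVec_add, mulVec_smul, dotProduct_add, dotProduct_smul, e0, e2, e3,
        smul_eq_mul, mul_zero, zero_add] at h'
      have : 2 * (β * γ) = 0 := by linear_combination h'
      simpa [h2] using this
    obtain ⟨a, b, rfl | rfl⟩ := hP.eq_comb hv.tangent h23
    · exact Or.inl (trilin_eq_zero_of_isFlecnodalDirection_comb hC₁ hC₂ hc huu
        (by simp [hP.gram]) (by simp [hP.gram]) hv)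
    · exact Or.inr (trilin_eq_zero_of_isFlecnodalDirection_comb hC₁ hC₂ hc huu
        (by simp [hP.gram]) (by simp [hP.gram]) hv)

theorem flecForm_adjugate_eq_zero_iff [IsAlgClosed F] (h2 : (2 : F) ≠ 0)
    (hA : A.IsSymm) (hC₁ : ∀ i j k, C i j k = C j i k) (hC₂ : ∀ i j k, C i j k = C i k j)
    {c : F} (hc : ∀ y z, trilin C u y z = c * (y ⬝ᵥ A *ᵥ z)) (hu : A *ᵥ u ≠ 0)
    (huu : u ⬝ᵥ A *ᵥ u = 0) :
    flecForm A.adjugate C = 0 ↔ ∃ v, IsFlecnodalDirection A C u v := by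
  have hs := dotProduct_mulVec_symm hA
  by_cases hdet : A.det = 0
  swap
  · exact flecForm_adjugate_eq_zero_iff_of_det_ne_zero h2
      (fun x => IsAlgClosed.exists_eq_mul_self x) hA hC₁ hC₂ hc
      (fun h => hu (by rw [h, mulVec_zero])) huu hdet
  by_cases hadj : A.adjugate = 0
  · obtain ⟨k, k', hkk, hk, hk'⟩ := exists_linearIndependent_ker_of_adjugate_eq_zero hA hadj
    have hl := LinearIndependent.pair_iff.mp hkk
    refine iff_of_true (by rw [hadj]; simp [flecForm]) ?_
    have key : ∀ v, v ≠ 0 → A *ᵥ v = 0 → trilin C v v v = 0 →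
        ∃ v, IsFlecnodalDirection A C u v := fun v hv0 hv hv3 =>
      ⟨v, linearIndependent_of_mulVec_eq_zero hu hv0 hv, by rw [hv, dotProduct_zero],
        by rw [hv, dotProduct_zero], hv3⟩
    by_cases hk3 : trilin C k k k = 0
    · exact key k (fun h => one_ne_zero (hl 1 0 (by simp [h])).1) hk hk3
    · let p : Cubic F := ⟨trilin C k k k, 3 * trilin C k k k', 3 * trilin C k k' k',
        trilin C k' k' k'⟩
      obtain ⟨s, hs⟩ := IsAlgClosed.exists_root p.toPoly
        (by rw [Cubic.degree_of_a_ne_zero hk3]; norm_num)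
      refine key (s • k + (1 : F) • k') (fun h => one_ne_zero (hl s 1 h).2)
        (by simp [mulVec_add, mulVec_smul, hk, hk']) ?_
      rw [trilin_self_comb hC₁ hC₂]
      simp [Cubic.toPoly, p] at hs
      linear_combination hs
  · obtain ⟨k, c', hk0, hc', hk, hker, hkadj⟩ :=
      exists_ker_eq_span_of_adjugate_ne_zero hA hdet hadj
    rw [flecForm_adjugate_of_ker hkadj]
    have hkA : ∀ x, k ⬝ᵥ A *ᵥ x = 0 := fun x => by rw [hs, hk, dotProduct_zero]
    constructor
    · intro h
      exact ⟨k, linearIndependent_of_mulVec_eq_zero hu hk0 hk, by rw [hk, dotProduct_zero],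
        by rw [hk, dotProduct_zero], by simpa [hc'] using h⟩
    · rintro ⟨v, hv⟩
      obtain ⟨a, b, hab⟩ : ∃ a b : F, v = a • u + b • k := by
        by_contra hcon
        have hli : LinearIndependent F ![v, u, k] := by
          refine linearIndependent_finCons.mpr ⟨linearIndependent_of_mulVec_eq_zero hu hk0 hk, fun hmem => hcon ?_⟩
          simp only [range_cons, range_empty, Set.union_empty, Set.singleton_union] at hmem
          obtain ⟨a, b, h⟩ := Submodule.mem_span_pair.mp hmem
          exact ⟨a, b, h.symm⟩
        obtain ⟨μ, hμ⟩ := eq_smul_of_forall_dotProduct_eq_zero hli (a := A *ᵥ v) (b := A *ᵥ u)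
          (by
            intro i
            fin_cases i
            exacts [hv.asymptotic, hv.tangent, hkA v])
          (by
            intro i
            fin_cases i
            exacts [(hs _ _).trans hv.tangent, huu, hkA u]) hu
        obtain ⟨t, ht⟩ := hker (v - μ • u) (by rw [mulVec_sub, mulVec_smul, hμ, sub_self])
        exact hcon ⟨μ, t, by rw [← ht]; abel⟩
      rw [hab] at hv
      rw [trilin_eq_zero_of_isFlecnodalDirection_comb hC₁ hC₂ hc huu
        ((hs _ _).trans (hkA u)) (hkA k) hv]
      simp

end

end FlecnodalForm

section LineRestriction

open MvPolynomial Matrix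

variable {K : Type*} [Field K]

lemma pderiv_comm_apply (i j : Fin 4) (f : MvPolynomial (Fin 4) K) :
    pderiv i (pderiv j f) = pderiv j (pderiv i f) := by
  have h : ⁅pderiv (R := K) i, pderiv (R := K) j⁆ = 0 := by
    refine MvPolynomial.derivation_ext fun k => ?_
    simp [Derivation.commutator_apply, pderiv_X, Pi.single_apply, apply_ite]
  have := congrArg (fun D => D f) h
  simpa [Derivation.commutator_apply, sub_eq_zero] using this

lemma derivation_aeval {S : Type*} [CommRing S] [Algebra K S] (D : Derivation K S S)
    (a : Fin 4 → S) (p : MvPolynomial (Fin 4) K) :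
    D (aeval a p) = ∑ i, aeval a (pderiv i p) * D (a i) := by
  induction p using MvPolynomial.induction_on with
  | C c => simp [← MvPolynomial.algebraMap_eq]
  | add p q hp hq => simp [hp, hq, add_mul, Finset.sum_add_distrib]
  | mul_X p j hp =>
    rw [map_mul, D.leibniz, hp, aeval_X]
    simp only [Derivation.leibniz, pderiv_X, smul_eq_mul, map_add, map_mul, aeval_X, add_mul,
      Finset.sum_add_distrib, Finset.mul_sum]
    congr 1
    · rw [Finset.sum_eq_single j]
      · simp
      · intro b _ hb
        simp [hb.symm]
      · simp
    · exact Finset.sum_congr rfl fun i _ => by ring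

lemma sum_aeval_pderiv_mul {S : Type*} [CommRing S] [Algebra K S] {f : MvPolynomial (Fin 4) K}
    {d : ℕ} (hf : f.IsHomogeneous d) (a : Fin 4 → S) :
    ∑ i, aeval a (pderiv i f) * a i = d * aeval a f := by
  have := congrArg (aeval a) hf.sum_X_mul_pderiv
  simpa [mul_comm] using this

/-- The Hessian matrix of `f`. -/
noncomputable def hessianMatrix (f : MvPolynomial (Fin 4) K) :
    Matrix (Fin 4) (Fin 4) (MvPolynomial (Fin 4) K) :=
  Matrix.of fun i j => pderiv i (pderiv j f)

/-- The third derivatives of `f`. -/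
noncomputable def thirdPartials (f : MvPolynomial (Fin 4) K) (i j k : Fin 4) :
    MvPolynomial (Fin 4) K :=
  pderiv i (pderiv j (pderiv k f))

/-- The flecnodal polynomial of `f`. -/
noncomputable def flecPoly (f : MvPolynomial (Fin 4) K) : MvPolynomial (Fin 4) K :=
  flecForm (hessianMatrix f).adjugate (thirdPartials f)

variable {L : Type*} [Field L] [Algebra K L]

/-- The value at `u` of the gradient of `f`. -/
noncomputable def gradAt (f : MvPolynomial (Fin 4) K) (u : Fin 4 → L) : Fin 4 → L :=
  fun i => aeval u (pderiv i f)

/-- The value at `u` of the Hessian matrix of `f`. -/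
noncomputable def hessAt (f : MvPolynomial (Fin 4) K) (u : Fin 4 → L) :
    Matrix (Fin 4) (Fin 4) L :=
  Matrix.of fun i j => aeval u (pderiv i (pderiv j f))

/-- The values at `u` of the third derivatives of `f`. -/
noncomputable def thirdAt (f : MvPolynomial (Fin 4) K) (u : Fin 4 → L) (i j k : Fin 4) : L :=
  aeval u (pderiv i (pderiv j (pderiv k f)))

/-- The restriction of `f` to the line parametrized by `u + t v`. -/
noncomputable def lineRestriction (f : MvPolynomial (Fin 4) K) (u v : Fin 4 → L) :
    Polynomial L :=
  aeval (fun i => Polynomial.C (u i) + Polynomial.X * Polynomial.C (v i)) f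

lemma aeval_flecPoly (f : MvPolynomial (Fin 4) K) (u : Fin 4 → L) :
    aeval u (flecPoly f) = flecForm (hessAt f u).adjugate (thirdAt f u) := by
  have h := map_flecForm (aeval u : MvPolynomial (Fin 4) K →ₐ[K] L).toRingHom
    (hessianMatrix f).adjugate (thirdPartials f)
  have h2 := RingHom.map_adjugate (aeval u : MvPolynomial (Fin 4) K →ₐ[K] L).toRingHom
    (hessianMatrix f)
  simp only [RingHom.mapMatrix_apply] at h2
  rw [h2] at h
  exact h

lemma hessAt_isSymm (f : MvPolynomial (Fin 4) K) (u : Fin 4 → L) : (hessAt f u).IsSymm := by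
  ext i j
  simp [hessAt, pderiv_comm_apply i j]

lemma thirdAt_left_comm (f : MvPolynomial (Fin 4) K) (u : Fin 4 → L) (i j k : Fin 4) :
    thirdAt f u i j k = thirdAt f u j i k := by
  rw [thirdAt, thirdAt, pderiv_comm_apply]

lemma thirdAt_right_comm (f : MvPolynomial (Fin 4) K) (u : Fin 4 → L) (i j k : Fin 4) :
    thirdAt f u i j k = thirdAt f u i k j := by
  rw [thirdAt, thirdAt, pderiv_comm_apply j k]

section Homogeneous

variable {f : MvPolynomial (Fin 4) K} {d : ℕ}

lemma gradAt_dotProduct_self (hf : f.IsHomogeneous d) (u : Fin 4 → L) :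
    gradAt f u ⬝ᵥ u = d * aeval u f :=
  sum_aeval_pderiv_mul hf u

lemma hessAt_mulVec_self (hf : f.IsHomogeneous d) (u : Fin 4 → L) :
    hessAt f u *ᵥ u = ((d - 1 : ℕ) : L) • gradAt f u := by
  ext i
  have := sum_aeval_pderiv_mul (hf.pderiv (i := i)) u
  simp only [← pderiv_comm_apply i] at this
  exact this

lemma trilin_thirdAt_self (hf : f.IsHomogeneous d) (u y z : Fin 4 → L) :
    trilin (thirdAt f u) u y z = ((d - 2 : ℕ) : L) * (y ⬝ᵥ hessAt f u *ᵥ z) := by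
  rw [trilin_left_comm (thirdAt_left_comm f u), trilin_right_comm (thirdAt_right_comm f u)]
  have h : ∀ i j, ∑ k, thirdAt f u i j k * u k =
      ((d - 2 : ℕ) : L) * hessAt f u i j := by
    intro i j
    have := sum_aeval_pderiv_mul ((hf.pderiv (i := j)).pderiv (i := i)) u
    rw [show d - 2 = d - 1 - 1 by omega]
    refine Eq.trans (Finset.sum_congr rfl fun k _ => ?_) this
    rw [thirdAt, pderiv_comm_apply j k, pderiv_comm_apply i k]
  simp only [trilin, h, dotProduct, mulVec, Finset.mul_sum, Finset.sum_mul]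
  exact Finset.sum_congr rfl fun i _ => Finset.sum_congr rfl fun j _ => by ring

end Homogeneous

lemma coeff_zero_lineRestriction (f : MvPolynomial (Fin 4) K) (u v : Fin 4 → L) :
    (lineRestriction f u v).coeff 0 = aeval u f := by
  rw [Polynomial.coeff_zero_eq_eval_zero, ← Polynomial.coe_aeval_eq_eval, lineRestriction]
  have h := MvPolynomial.comp_aeval
    (f := fun i => Polynomial.C (u i) + Polynomial.X * Polynomial.C (v i))
    ((Polynomial.aeval (0 : L)).restrictScalars K)
  have := DFunLike.congr_fun h f
  simpa using this

lemma derivative_lineRestriction (f : MvPolynomial (Fin 4) K) (u v : Fin 4 → L) :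
    (lineRestriction f u v).derivative =
      ∑ i, Polynomial.C (v i) * lineRestriction (pderiv i f) u v := by
  have := derivation_aeval ((Polynomial.derivative' (R := L)).restrictScalars K)
    (fun i => Polynomial.C (u i) + Polynomial.X * Polynomial.C (v i)) f
  refine Eq.trans this (Finset.sum_congr rfl fun i _ => ?_)
  rw [mul_comm]
  congr 1
  simp [Polynomial.derivative']

lemma succ_mul_coeff_succ_lineRestriction (f : MvPolynomial (Fin 4) K) (u v : Fin 4 → L) (n : ℕ) :
    ((n : L) + 1) * (lineRestriction f u v).coeff (n + 1) =
      ∑ i, v i * (lineRestriction (pderiv i f) u v).coeff n := by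
  have := congrArg (fun p => Polynomial.coeff p n) (derivative_lineRestriction f u v)
  simp only [Polynomial.coeff_derivative, Polynomial.finsetSum_coeff,
    Polynomial.coeff_C_mul] at this
  rw [← this, mul_comm]

lemma coeff_one_lineRestriction (f : MvPolynomial (Fin 4) K) (u v : Fin 4 → L) :
    (lineRestriction f u v).coeff 1 = gradAt f u ⬝ᵥ v := by
  have := succ_mul_coeff_succ_lineRestriction f u v 0
  simp only [coeff_zero_lineRestriction, Nat.cast_zero, zero_add, one_mul] at this
  rw [this, dotProduct_comm]
  rfl

lemma two_mul_coeff_two_lineRestriction (f : MvPolynomial (Fin 4) K) (u v : Fin 4 → L) :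
    2 * (lineRestriction f u v).coeff 2 = v ⬝ᵥ hessAt f u *ᵥ v := by
  have h : (2 : L) * (lineRestriction f u v).coeff 2 =
      ∑ i, v i * (lineRestriction (pderiv i f) u v).coeff 1 := by
    rw [← succ_mul_coeff_succ_lineRestriction f u v 1]
    norm_num
  simp only [h, coeff_one_lineRestriction, dotProduct, mulVec, gradAt, hessAt, of_apply]
  simp only [pderiv_comm_apply]

lemma six_mul_coeff_three_lineRestriction (f : MvPolynomial (Fin 4) K) (u v : Fin 4 → L) :
    6 * (lineRestriction f u v).coeff 3 = trilin (thirdAt f u) v v v := by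
  have h : (3 : L) * (lineRestriction f u v).coeff 3 =
      ∑ i, v i * (lineRestriction (pderiv i f) u v).coeff 2 := by
    rw [← succ_mul_coeff_succ_lineRestriction f u v 2]
    norm_num
  have h2 : ∀ i, 2 * (v i * (lineRestriction (pderiv i f) u v).coeff 2) =
      (∑ j, (∑ k, thirdAt f u i j k * v k) * v j) * v i := by
    intro i
    rw [mul_left_comm, two_mul_coeff_two_lineRestriction, mul_comm]
    simp only [dotProduct, mulVec, hessAt, thirdAt, of_apply]
    refine congrArg (· * v i) (Finset.sum_congr rfl fun j _ => ?_)
    rw [mul_comm]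
    refine congrArg (· * v j) (Finset.sum_congr rfl fun k _ => ?_)
    rw [pderiv_comm_apply k i, pderiv_comm_apply j i]
  rw [show (6 : L) = 2 * 3 by norm_num, mul_assoc, h, Finset.mul_sum,
    Finset.sum_congr rfl fun i _ => h2 i, trilin]

end LineRestriction

section FlecnodalPolynomial

open MvPolynomial Matrix

variable {K : Type*} [Field K]

lemma natCast_ne_zero_of_ringChar {d : ℕ} (h : ringChar K = 0 ∨ d < ringChar K) {m : ℕ}
    (hm : m ≠ 0) (hmd : m ≤ d) : (m : K) ≠ 0 := by
  intro hmz
  have hdvd := (ringChar.spec K m).mp hmz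
  rcases h with h | h
  · rw [h, zero_dvd_iff] at hdvd
    exact hm hdvd
  · have := Nat.le_of_dvd (Nat.pos_of_ne_zero hm) hdvd
    omega

lemma isHomogeneous_det {σ : Type*} {n k : ℕ} {M : Matrix (Fin n) (Fin n) (MvPolynomial σ K)}
    (hM : ∀ i j, (M i j).IsHomogeneous k) : M.det.IsHomogeneous (n * k) := by
  rw [det_apply']
  refine IsHomogeneous.sum _ _ _ fun τ _ => ?_
  have h := IsHomogeneous.prod Finset.univ (fun i => M (τ i) i) (fun _ => k) fun i _ => hM _ _
  have h' := h.C_mul ((Equiv.Perm.sign τ : ℤ) : K)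
  simpa using h'

lemma isHomogeneous_adjugate {σ : Type*} {n k : ℕ}
    {M : Matrix (Fin (n + 1)) (Fin (n + 1)) (MvPolynomial σ K)}
    (hM : ∀ i j, (M i j).IsHomogeneous k) (i j : Fin (n + 1)) :
    (M.adjugate i j).IsHomogeneous (n * k) := by
  rw [adjugate_fin_succ_eq_det_submatrix]
  have h := (isHomogeneous_det (M := M.submatrix j.succAbove i.succAbove)
    fun a b => hM _ _).C_mul ((-1) ^ (j + i : ℕ))
  simpa using h

lemma isHomogeneous_flecForm {M : Matrix (Fin 4) (Fin 4) (MvPolynomial (Fin 4) K)}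
    {C : Fin 4 → Fin 4 → Fin 4 → MvPolynomial (Fin 4) K} {a b : ℕ}
    (hM : ∀ i j, (M i j).IsHomogeneous a) (hC : ∀ i j k, (C i j k).IsHomogeneous b) :
    (flecForm M C).IsHomogeneous (3 * a + 2 * b) := by
  have hs : ∀ {n : ℕ} {F : Fin 4 → Fin 4 → MvPolynomial (Fin 4) K},
      (∀ i j, (F i j).IsHomogeneous n) → (∑ i, ∑ j, F i j).IsHomogeneous n := fun h =>
    IsHomogeneous.sum _ _ _ fun i _ => IsHomogeneous.sum _ _ _ fun j _ => h i j
  have h4 : (flecForm M C) =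
      MvPolynomial.C (4 : K) * (∑ i, ∑ j, M i j * ∑ k, ∑ l, M k l * ∑ m, ∑ n,
        M m n * (C i k m * C j l n)) -
      MvPolynomial.C (3 : K) * (∑ m, ∑ n, M m n *
        ((∑ i, ∑ j, M i j * C i j m) * (∑ k, ∑ l, M k l * C k l n))) := by
    simp only [map_ofNat]
    rfl
  rw [h4]
  refine IsHomogeneous.sub (IsHomogeneous.C_mul ?_ _) (IsHomogeneous.C_mul ?_ _)
  · rw [show 3 * a + 2 * b = a + (a + (a + (b + b))) by ring]
    exact hs fun i j => (hM _ _).mul (hs fun k l => (hM _ _).mul (hs fun m n =>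
      (hM _ _).mul ((hC _ _ _).mul (hC _ _ _))))
  · rw [show 3 * a + 2 * b = a + ((a + b) + (a + b)) by ring]
    exact hs fun m n => (hM _ _).mul ((hs fun i j => (hM _ _).mul (hC _ _ _)).mul
      (hs fun i j => (hM _ _).mul (hC _ _ _)))

lemma isHomogeneous_flecPoly {f : MvPolynomial (Fin 4) K} {d : ℕ} (hd : 3 ≤ d)
    (hf : f.IsHomogeneous d) : (flecPoly f).IsHomogeneous (11 * d - 24) := by
  have h := isHomogeneous_flecForm (M := (hessianMatrix f).adjugate) (C := thirdPartials f)
    (isHomogeneous_adjugate (n := 3) fun i j => (hf.pderiv (i := j)).pderiv (i := i))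
    fun i j k => ((hf.pderiv (i := k)).pderiv (i := j)).pderiv (i := i)
  rwa [show 3 * (3 * (d - 1 - 1)) + 2 * (d - 1 - 1 - 1) = 11 * d - 24 by omega] at h

variable {f : MvPolynomial (Fin 4) K} {d : ℕ}

lemma aeval_eq_eval_apply (p : MvPolynomial (Fin 4) K) (u : Fin 4 → K) :
    aeval u p = eval u p := by
  rw [← MvPolynomial.coe_aeval_eq_eval]
  rfl

lemma isFlecnodalDirection_iff_ordGE (hd : 3 ≤ d) (hchar : ringChar K = 0 ∨ d < ringChar K)
    (hf : f.IsHomogeneous d) {u : Fin 4 → K} (hfu : eval u f = 0) (v : Fin 4 → K) :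
    IsFlecnodalDirection (hessAt f u) (thirdAt f u) u v ↔
      LinearIndependent K ![u, v] ∧ ordGE f u v 4 := by
  have h2 : (2 : K) ≠ 0 :=
    mod_cast natCast_ne_zero_of_ringChar hchar (m := 2) two_ne_zero (by omega)
  have h3 : (3 : K) ≠ 0 :=
    mod_cast natCast_ne_zero_of_ringChar hchar (m := 3) three_ne_zero (by omega)
  have hd1 : ((d - 1 : ℕ) : K) ≠ 0 :=
    natCast_ne_zero_of_ringChar hchar (by omega) (by omega)
  have h6 : (6 : K) ≠ 0 := by
    rw [show (6 : K) = 2 * 3 by norm_num]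
    exact mul_ne_zero h2 h3
  have hr : restrictLine f u v = lineRestriction f u v := rfl
  have e0 : (lineRestriction f u v).coeff 0 = 0 := by
    rw [coeff_zero_lineRestriction, aeval_eq_eval_apply, hfu]
  have e1 : u ⬝ᵥ hessAt f u *ᵥ v = (d - 1 : ℕ) * (lineRestriction f u v).coeff 1 := by
    rw [coeff_one_lineRestriction, dotProduct_mulVec_symm (hessAt_isSymm f u),
      hessAt_mulVec_self hf, dotProduct_smul, smul_eq_mul, dotProduct_comm]
  have e2 := two_mul_coeff_two_lineRestriction f u v
  have e3 := six_mul_coeff_three_lineRestriction f u v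
  constructor
  · rintro ⟨hl, ht, ha, hc⟩
    refine ⟨hl, fun j hj => ?_⟩
    rw [hr]
    interval_cases j
    · exact e0
    · exact (mul_eq_zero.mp (e1.symm.trans ht)).resolve_left hd1
    · exact (mul_eq_zero.mp (e2.trans ha)).resolve_left h2
    · exact (mul_eq_zero.mp (e3.trans hc)).resolve_left h6
  · rintro ⟨hl, h⟩
    rw [ordGE, hr] at h
    refine ⟨hl, ?_, ?_, ?_⟩
    · rw [e1, h 1 (by norm_num), mul_zero]
    · rw [← e2, h 2 (by norm_num), mul_zero]
    · rw [← e3, h 3 (by norm_num), mul_zero]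

theorem eval_flecPoly_eq_zero_iff [IsAlgClosed K] (hd : 3 ≤ d)
    (hchar : ringChar K = 0 ∨ d < ringChar K) (hf : IsSmoothSurfaceOfDegree f d)
    {u : Fin 4 → K} (hu : u ≠ 0) (hfu : eval u f = 0) :
    eval u (flecPoly f) = 0 ↔ ∃ v, LinearIndependent K ![u, v] ∧ ordGE f u v 4 := by
  have h2 : (2 : K) ≠ 0 :=
    mod_cast natCast_ne_zero_of_ringChar hchar (m := 2) two_ne_zero (by omega)
  have hd1 : ((d - 1 : ℕ) : K) ≠ 0 :=
    natCast_ne_zero_of_ringChar hchar (by omega) (by omega)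
  have hg : gradAt f u ≠ 0 := by
    obtain ⟨i, hi⟩ := hf.2 u hu
    exact fun h => hi (congrFun h i)
  simp only [← isFlecnodalDirection_iff_ordGE hd hchar hf.1 hfu]
  rw [← aeval_eq_eval_apply, aeval_flecPoly]
  refine flecForm_adjugate_eq_zero_iff h2 (hessAt_isSymm f u) (thirdAt_left_comm f u)
    (thirdAt_right_comm f u) (trilin_thirdAt_self hf.1 u) ?_ ?_
  · rw [hessAt_mulVec_self hf.1]
    exact smul_ne_zero hd1 hg
  · rw [hessAt_mulVec_self hf.1, dotProduct_smul, dotProduct_comm, gradAt_dotProduct_self hf.1,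
      aeval_eq_eval_apply, hfu, mul_zero, smul_zero]

end FlecnodalPolynomial

section GenericPoint

open MvPolynomial Matrix

universe w

variable {K : Type w} [Field K] {f : MvPolynomial (Fin 4) K} {d : ℕ}

/-- The partial derivatives of a smooth form generate an ideal whose radical contains the
variables. -/
lemma X_mem_radical_span_pderiv [IsAlgClosed K] (hf : IsSmoothSurfaceOfDegree f d) (i : Fin 4) :
    X i ∈ (Ideal.span (Set.range fun j => pderiv j f)).radical := by
  rw [← vanishingIdeal_zeroLocus_eq_radical (K := K), mem_vanishingIdeal_iff]
  intro x hx
  rw [mem_zeroLocus_iff] at hx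
  by_cases h0 : x = 0
  · simp [h0]
  · obtain ⟨j, hj⟩ := hf.2 x h0
    refine absurd (hx _ (Ideal.subset_span ⟨j, rfl⟩)) ?_
    rwa [aeval_eq_eval_apply]

lemma mem_radical_span_aeval_pderiv [IsAlgClosed K] (hf : IsSmoothSurfaceOfDegree f d)
    {S : Type*} [CommRing S] [Algebra K S] (a : Fin 4 → S) (i : Fin 4) :
    a i ∈ (Ideal.span (Set.range fun j => aeval a (pderiv j f))).radical := by
  obtain ⟨n, hn⟩ := X_mem_radical_span_pderiv hf i
  refine ⟨n, ?_⟩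
  have := Ideal.mem_map_of_mem (aeval a : MvPolynomial (Fin 4) K →ₐ[K] S) hn
  rw [Ideal.map_span, ← Set.range_comp] at this
  simpa [Function.comp_def] using this

lemma gradAt_ne_zero [IsAlgClosed K] (hf : IsSmoothSurfaceOfDegree f d)
    {L : Type*} [Field L] [Algebra K L] {a : Fin 4 → L} (ha : a ≠ 0) : gradAt f a ≠ 0 := by
  intro h
  obtain ⟨i, hi⟩ := Function.ne_iff.mp ha
  have hm := mem_radical_span_aeval_pderiv hf a i
  have hz : Ideal.span (Set.range fun j => aeval a (pderiv j f)) = ⊥ := by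
    rw [Ideal.span_eq_bot]
    rintro _ ⟨j, rfl⟩
    exact congrFun h j
  rw [hz] at hm
  obtain ⟨n, hn⟩ := hm
  exact hi (eq_zero_of_pow_eq_zero (by simpa using hn))

/-- A point with coordinates in an extension `L` of `K` which is generic on a component of the
surface `f = 0`. -/
structure IsGenericSurfacePoint {L : Type*} [Field L] [Algebra K L] (f : MvPolynomial (Fin 4) K)
    (u : Fin 4 → L) : Prop where
  ne_zero : u ≠ 0
  aeval_eq_zero : ∀ p, f ∣ p → aeval u p = 0
  exists_derivation : ∀ x : Fin 4 → L, gradAt f u ⬝ᵥ x = 0 →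
    ∃ D : Derivation K L L, ∀ i, D (u i) = x i

lemma aeval_inl_add_inr {L : Type*} [Field L] [Algebra K L] (u x : Fin 4 → L)
    (p : MvPolynomial (Fin 4) K) :
    aeval (fun i => TrivSqZeroExt.inl (u i) + TrivSqZeroExt.inr (x i) : Fin 4 →
      TrivSqZeroExt L L) p = TrivSqZeroExt.inl (aeval u p) +
        TrivSqZeroExt.inr (gradAt p u ⬝ᵥ x) := by
  induction p using MvPolynomial.induction_on with
  | C c =>
    simp [gradAt, dotProduct, ← MvPolynomial.algebraMap_eq, TrivSqZeroExt.algebraMap_eq_inl']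
  | add p q hp hq =>
    have h : gradAt (p + q) u = gradAt p u + gradAt q u := by ext; simp [gradAt]
    rw [map_add, hp, hq, h, add_dotProduct]
    ext <;> simp
  | mul_X p j hp =>
    have h : gradAt (p * X j) u ⬝ᵥ x = aeval u p * x j + u j * (gradAt p u ⬝ᵥ x) := by
      simp only [gradAt, dotProduct, Derivation.leibniz, pderiv_X, smul_eq_mul, map_add, map_mul,
        aeval_X, add_mul, Finset.sum_add_distrib, Finset.mul_sum, mul_assoc]
      congr 1
      rw [Finset.sum_eq_single j]
      · simp
      · intro b _ hb
        simp [hb.symm]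
      · simp
    rw [map_mul, hp, h, aeval_X]
    ext <;> simp [TrivSqZeroExt.snd_mul, mul_comm, add_comm]

lemma exists_derivation_of_formallySmooth {B L : Type*} [CommRing B] [Algebra K B] [Field L]
    [Algebra K L] [Algebra B L] [IsScalarTower K B L] [Algebra.FormallySmooth B L]
    (ψ : B →ₐ[K] TrivSqZeroExt L L) (hψ : ∀ b, (ψ b).fst = algebraMap B L b) :
    ∃ D : Derivation K L L, ∀ b, D (algebraMap B L b) = (ψ b).snd := by
  let _ : Algebra B (TrivSqZeroExt L L) := ψ.toRingHom.toAlgebra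
  let g : TrivSqZeroExt L L →ₐ[B] L :=
    { (TrivSqZeroExt.fstHom L L L).toRingHom with commutes' := hψ }
  let φ : L →ₐ[B] TrivSqZeroExt L L := Algebra.FormallySmooth.liftOfSurjective
    (AlgHom.id B L) g (fun l => ⟨TrivSqZeroExt.inl l, rfl⟩) ⟨2, TrivSqZeroExt.kerIdeal_sq L L⟩
  have hφ : ∀ l, (φ l).fst = l := fun l =>
    Algebra.FormallySmooth.liftOfSurjective_apply (AlgHom.id B L) g _ _ l
  have hφB : ∀ b, φ (algebraMap B L b) = ψ b := fun b => φ.commutes b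
  have hK : ∀ c : K, φ (algebraMap K L c) = TrivSqZeroExt.inl (algebraMap K L c) := by
    intro c
    rw [IsScalarTower.algebraMap_apply K B L, hφB, AlgHom.commutes,
      ← IsScalarTower.algebraMap_apply K B L]
    rfl
  refine ⟨Derivation.mk' (R := K)
    { toFun := fun l => (φ l).snd, map_add' := fun a b => by simp, map_smul' := fun c a => ?_ }
    fun a b => ?_, fun b => ?_⟩
  · rw [Algebra.smul_def, map_mul, hK]
    simp [TrivSqZeroExt.snd_mul, Algebra.smul_def]
  · simp [TrivSqZeroExt.snd_mul, hφ, mul_comm]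
  · simp [hφB]

lemma gradAt_eq_smul_of_mul {L : Type*} [Field L] [Algebra K L] {p q : MvPolynomial (Fin 4) K}
    {u : Fin 4 → L} (hp : aeval u p = 0) : gradAt (p * q) u = aeval u q • gradAt p u := by
  ext i
  simp [gradAt, hp]

lemma exists_isSepClosed_formallySmooth (K : Type w) [Field K] (B : Type w) [CommRing B]
    [IsDomain B] [Algebra K B] :
    ∃ (L : Type w) (_ : Field L) (_ : Algebra K L) (_ : Algebra B L) (_ : IsScalarTower K B L),
      IsSepClosed L ∧ Algebra.FormallySmooth B L ∧ Function.Injective (algebraMap B L) := by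
  let F := FractionRing B
  let φ : B →+* SeparableClosure F := (algebraMap F (SeparableClosure F)).comp (algebraMap B F)
  let _ : Algebra B (SeparableClosure F) := φ.toAlgebra
  let _ : Algebra K (SeparableClosure F) := (φ.comp (algebraMap K B)).toAlgebra
  have : IsScalarTower B F (SeparableClosure F) := IsScalarTower.of_algebraMap_eq fun _ => rfl
  have : IsScalarTower K B (SeparableClosure F) := IsScalarTower.of_algebraMap_eq fun _ => rfl
  have : Algebra.FormallySmooth B F :=
    Algebra.FormallySmooth.of_isLocalization (nonZeroDivisors B)
  have : Algebra.FormallyEtale F (SeparableClosure F) := Algebra.FormallyEtale.of_isSeparable F _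
  refine ⟨SeparableClosure F, inferInstance, inferInstance, inferInstance, inferInstance,
    inferInstance, Algebra.FormallySmooth.comp B F _, ?_⟩
  exact (algebraMap F (SeparableClosure F)).injective.comp (IsFractionRing.injective B F)

theorem exists_isGenericSurfacePoint [IsAlgClosed K] (hd : 1 ≤ d)
    (hf : IsSmoothSurfaceOfDegree f d) :
    ∃ (L : Type w) (_ : Field L) (_ : Algebra K L) (_ : IsSepClosed L) (u : Fin 4 → L),
      IsGenericSurfacePoint f u := by
  have hf0 : f ≠ 0 := by
    rintro rfl
    obtain ⟨i, hi⟩ := hf.2 (fun _ => 1) (fun h => one_ne_zero (congrFun h 0))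
    simp at hi
  have hfu : ¬ IsUnit f := by
    intro h
    have h0 : constantCoeff f = 0 := hf.1.coeff_eq_zero (by simp; omega)
    exact (h.map constantCoeff).ne_zero h0
  obtain ⟨p, hp, q, rfl⟩ := WfDvdMonoid.exists_irreducible_factor hfu hf0
  let I : Ideal (MvPolynomial (Fin 4) K) := Ideal.span {p}
  have hI : I.IsPrime := (Ideal.span_singleton_prime hp.ne_zero).mpr hp.prime
  let B := MvPolynomial (Fin 4) K ⧸ I
  obtain ⟨L, _, _, _, _, hL, _, hBL⟩ := exists_isSepClosed_formallySmooth K B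
  let u : Fin 4 → L := fun i => algebraMap B L (Ideal.Quotient.mk I (X i))
  have hu : ∀ q, aeval u q = algebraMap B L (Ideal.Quotient.mk I q) := by
    intro q
    have h : aeval u = (IsScalarTower.toAlgHom K B L).comp (Ideal.Quotient.mkₐ K I) :=
      MvPolynomial.algHom_ext fun i => aeval_X u i
    rw [h]
    rfl
  have huz : ∀ q, p ∣ q → aeval u q = 0 := by
    intro q hq
    rw [hu, Ideal.Quotient.eq_zero_iff_mem.mpr (Ideal.mem_span_singleton.mpr hq), map_zero]
  have hu0 : u ≠ 0 := by
    intro h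
    have hX : ∀ i, p ∣ X i := by
      intro i
      rw [← Ideal.mem_span_singleton, ← Ideal.Quotient.eq_zero_iff_mem]
      exact hBL ((congrFun h i).trans (map_zero _).symm)
    have h01 := ((hp.dvd_symm (MvPolynomial.X_prime.irreducible) (hX 0)).trans (hX 1))
    rw [MvPolynomial.X_dvd_X] at h01
    simp at h01
  refine ⟨L, inferInstance, inferInstance, hL, u, hu0,
    fun r hr => huz r ((dvd_mul_right p q).trans hr), fun x hx => ?_⟩
  have hg := gradAt_ne_zero hf hu0
  rw [gradAt_eq_smul_of_mul (huz p dvd_rfl)] at hg hx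
  have hpx : gradAt p u ⬝ᵥ x = 0 := by
    rw [smul_dotProduct, smul_eq_mul] at hx
    exact (mul_eq_zero.mp hx).resolve_left fun h => hg (by rw [h, zero_smul])
  let ψ : B →ₐ[K] TrivSqZeroExt L L := Ideal.Quotient.liftₐ I
    (aeval fun i => TrivSqZeroExt.inl (u i) + TrivSqZeroExt.inr (x i)) (by
      intro r hr
      obtain ⟨s, rfl⟩ := Ideal.mem_span_singleton.mp hr
      rw [map_mul, aeval_inl_add_inr, huz p dvd_rfl, hpx]
      simp)
  have hψ : ∀ r, ψ (Ideal.Quotient.mk I r) = TrivSqZeroExt.inl (aeval u r) +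
      TrivSqZeroExt.inr (gradAt r u ⬝ᵥ x) := fun r => aeval_inl_add_inr u x r
  obtain ⟨D, hD⟩ := exists_derivation_of_formallySmooth ψ (by
    intro b
    obtain ⟨r, rfl⟩ := Ideal.Quotient.mk_surjective b
    rw [hψ, ← hu]
    simp)
  refine ⟨D, fun i => ?_⟩
  rw [hD, hψ]
  simp [gradAt, dotProduct, pderiv_X, Pi.single_apply, apply_ite (aeval u)]

end GenericPoint

section LineContainment

open MvPolynomial Matrix

variable {K : Type*} [Field K] {L : Type*} [Field L] [Algebra K L]

lemma lineRestriction_monomial_degree_coeff (u v : Fin 4 → L) (s : Fin 4 →₀ ℕ) (c : K) :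
    (lineRestriction (monomial s c) u v).natDegree ≤ s.degree ∧
      (lineRestriction (monomial s c) u v).coeff s.degree = aeval v (monomial s c) := by
  induction s using Finsupp.induction_linear generalizing c with
  | zero => simp [lineRestriction, Polynomial.algebraMap_apply]
  | add s t hs ht =>
    obtain ⟨hs1, hs2⟩ := hs c
    obtain ⟨ht1, ht2⟩ := ht (1 : K)
    have h : lineRestriction (monomial (s + t) c) u v =
        lineRestriction (monomial s c) u v * lineRestriction (monomial t (1 : K)) u v := by
      rw [lineRestriction, lineRestriction, lineRestriction, ← map_mul, monomial_mul, mul_one]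
    rw [h, map_add]
    refine ⟨Polynomial.natDegree_mul_le_of_le hs1 ht1, ?_⟩
    rw [Polynomial.coeff_mul_add_eq_of_natDegree_le hs1 ht1, hs2, ht2, ← map_mul, monomial_mul, mul_one]
  | single i k =>
    have h1 : (Polynomial.C (u i) + Polynomial.X * Polynomial.C (v i)).natDegree ≤ 1 := by
      compute_degree
    have h : lineRestriction (monomial (Finsupp.single i k) c) u v =
        Polynomial.C (algebraMap K L c) *
          (Polynomial.C (u i) + Polynomial.X * Polynomial.C (v i)) ^ k := by
      simp [lineRestriction, aeval_monomial, Polynomial.algebraMap_apply]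
    have h2 := Polynomial.coeff_pow_of_natDegree_le (m := k) h1
    rw [mul_one] at h2
    rw [h, Finsupp.degree_single]
    refine ⟨(Polynomial.natDegree_C_mul_le _ _).trans
      ((Polynomial.natDegree_pow_le_of_le k h1).trans_eq (mul_one k)), ?_⟩
    rw [Polynomial.coeff_C_mul, h2, aeval_monomial]
    simp

lemma lineRestriction_eq_sum (p : MvPolynomial (Fin 4) K) (u v : Fin 4 → L) :
    lineRestriction p u v = ∑ s ∈ p.support, lineRestriction (monomial s (p.coeff s)) u v := by
  conv_lhs => rw [p.as_sum]
  simp only [lineRestriction, map_sum]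

variable {p : MvPolynomial (Fin 4) K} {n : ℕ}

lemma natDegree_lineRestriction_le (hp : p.IsHomogeneous n) (u v : Fin 4 → L) :
    (lineRestriction p u v).natDegree ≤ n := by
  rw [lineRestriction_eq_sum]
  refine Polynomial.natDegree_sum_le_of_forall_le _ _ fun s hs => ?_
  rw [hp.degree_eq_sum_deg_support hs]
  exact (lineRestriction_monomial_degree_coeff u v s _).1

lemma coeff_lineRestriction_of_isHomogeneous (hp : p.IsHomogeneous n) (u v : Fin 4 → L) :
    (lineRestriction p u v).coeff n = aeval v p := by
  rw [lineRestriction_eq_sum, Polynomial.finsetSum_coeff]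
  conv_rhs => rw [p.as_sum, map_sum]
  refine Finset.sum_congr rfl fun s hs => ?_
  rw [hp.degree_eq_sum_deg_support hs]
  exact (lineRestriction_monomial_degree_coeff u v s _).2

lemma exists_derivation_polynomial (D : Derivation K L L) :
    ∃ E : Derivation K (Polynomial L) (Polynomial L),
      E Polynomial.X = 0 ∧ ∀ a, E (Polynomial.C a) = Polynomial.C (D a) := by
  refine ⟨PolynomialModule.equivPolynomialSelf.compDer D.mapCoeffs, ?_, fun a => ?_⟩
  · change PolynomialModule.equivPolynomialSelf (D.mapCoeffs Polynomial.X) = 0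
    simp
  · simp

/-- The restriction to the line parametrized by `u + t v` of the derivative of `f` along `w`. -/
noncomputable def lineGrad (f : MvPolynomial (Fin 4) K) (u v w : Fin 4 → L) : Polynomial L :=
  ∑ i, lineRestriction (pderiv i f) u v * Polynomial.C (w i)

lemma lineGrad_add (f : MvPolynomial (Fin 4) K) (u v w w' : Fin 4 → L) :
    lineGrad f u v (w + w') = lineGrad f u v w + lineGrad f u v w' := by
  simp [lineGrad, mul_add, Finset.sum_add_distrib]

lemma lineGrad_smul (f : MvPolynomial (Fin 4) K) (u v w : Fin 4 → L) (c : L) :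
    lineGrad f u v (c • w) = Polynomial.C c * lineGrad f u v w := by
  simp [lineGrad, Finset.mul_sum, mul_left_comm]

lemma lineGrad_single (f : MvPolynomial (Fin 4) K) (u v : Fin 4 → L) (i : Fin 4) :
    lineGrad f u v (Pi.single i 1) = lineRestriction (pderiv i f) u v := by
  simp [lineGrad, Pi.single_apply, apply_ite Polynomial.C]

lemma derivative_lineRestriction_eq_lineGrad (f : MvPolynomial (Fin 4) K) (u v : Fin 4 → L) :
    (lineRestriction f u v).derivative = lineGrad f u v v := by
  rw [derivative_lineRestriction, lineGrad]
  exact Finset.sum_congr rfl fun i _ => mul_comm _ _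

lemma derivation_lineRestriction {D : Derivation K L L}
    {E : Derivation K (Polynomial L) (Polynomial L)} (hX : E Polynomial.X = 0)
    (hC : ∀ a, E (Polynomial.C a) = Polynomial.C (D a)) (f : MvPolynomial (Fin 4) K)
    (u v : Fin 4 → L) :
    E (lineRestriction f u v) = lineGrad f u v (fun i => D (u i)) +
      Polynomial.X * lineGrad f u v (fun i => D (v i)) := by
  rw [lineRestriction, derivation_aeval, lineGrad, lineGrad, Finset.mul_sum,
    ← Finset.sum_add_distrib]
  refine Finset.sum_congr rfl fun i _ => ?_
  rw [← lineRestriction, map_add, hC, Derivation.leibniz, hX, hC, smul_zero, add_zero, smul_eq_mul,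
    mul_add, mul_left_comm]

variable {f : MvPolynomial (Fin 4) K} {d : ℕ}

lemma lineGrad_self_add (hf : f.IsHomogeneous d) (u v : Fin 4 → L) :
    lineGrad f u v u + Polynomial.X * lineGrad f u v v =
      (d : Polynomial L) * lineRestriction f u v := by
  have h := sum_aeval_pderiv_mul hf
    (fun i => Polynomial.C (u i) + Polynomial.X * Polynomial.C (v i))
  rw [lineRestriction, ← h, lineGrad, lineGrad, Finset.mul_sum, ← Finset.sum_add_distrib]
  refine Finset.sum_congr rfl fun i _ => ?_
  rw [← lineRestriction, mul_add, mul_left_comm]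

lemma coeff_lineGrad (hf : f.IsHomogeneous d) (u v w : Fin 4 → L) :
    (lineGrad f u v w).coeff (d - 1) = gradAt f v ⬝ᵥ w := by
  simp only [lineGrad, Polynomial.finsetSum_coeff, Polynomial.coeff_mul_C,
    coeff_lineRestriction_of_isHomogeneous hf.pderiv]
  rfl

/-- If the velocity of the moving point `u` is `v` and the line spanned by `u` and `v` does not
move, then the surface contains the line. -/
theorem lineRestriction_eq_zero_of_derivation (hf : f.IsHomogeneous d)
    (hd : ∀ m : ℕ, m ≠ 0 → m ≤ d → (m : L) ≠ 0) {u v : Fin 4 → L} (hu : aeval u f = 0)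
    (D : Derivation K L L) (hDu : ∀ i, D (u i) = v i) {a b : L}
    (hDv : ∀ i, D (v i) = a * u i + b * v i) : lineRestriction f u v = 0 := by
  obtain ⟨E, hX, hC⟩ := exists_derivation_polynomial D
  have hDu' : (fun i => D (u i)) = v := funext hDu
  have hDv' : (fun i => D (v i)) = a • u + b • v := funext hDv
  have hE := derivation_lineRestriction hX hC f u v
  have hS := lineGrad_self_add hf u v
  rw [hDu', hDv', lineGrad_add, lineGrad_smul, lineGrad_smul] at hE
  rw [← derivative_lineRestriction_eq_lineGrad] at hE hS
  have key : ∀ m ≤ d, Polynomial.X ^ (m + 1) ∣ lineRestriction f u v := by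
    intro m
    induction m with
    | zero =>
      intro _
      rw [zero_add, pow_one, Polynomial.X_dvd_iff, coeff_zero_lineRestriction, hu]
    | succ m ih =>
      intro hm
      obtain ⟨q, hq⟩ := ih (by omega)
      have hh' : (lineRestriction f u v).derivative =
          Polynomial.X ^ m * (((m + 1 : ℕ) : Polynomial L) * q + Polynomial.X * q.derivative) := by
        rw [hq, Polynomial.derivative_mul, Polynomial.derivative_X_pow, Nat.add_sub_cancel,
          Polynomial.C_eq_natCast]
        ring
      have hEh : E (lineRestriction f u v) = Polynomial.X ^ (m + 1) * E q := by
        rw [hq, Derivation.leibniz, Derivation.leibniz_pow, hX]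
        simp
      have hu' : lineGrad f u v u = (d : Polynomial L) * lineRestriction f u v -
          Polynomial.X * (lineRestriction f u v).derivative := by
        rw [← hS]
        ring
      rw [hu', hEh, hh', hq] at hE
      have hX : Polynomial.X ∣ ((m + 1 : ℕ) : Polynomial L) * q := by
        have hm0 : (Polynomial.X : Polynomial L) ^ m ≠ 0 := pow_ne_zero _ Polynomial.X_ne_zero
        refine ⟨E q - q.derivative - Polynomial.C a * ((d : Polynomial L) * Polynomial.X * q -
          Polynomial.X * (((m + 1 : ℕ) : Polynomial L) * q + Polynomial.X * q.derivative)) -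
          Polynomial.C b * (((m + 1 : ℕ) : Polynomial L) * q + Polynomial.X * q.derivative),
          mul_left_cancel₀ hm0 ?_⟩
        linear_combination -hE
      rw [Polynomial.X_dvd_iff, Polynomial.coeff_natCast_mul] at hX
      have hq0 := (mul_eq_zero.mp hX).resolve_left (hd (m + 1) (by omega) hm)
      rw [hq, pow_succ]
      exact mul_dvd_mul_left _ (Polynomial.X_dvd_iff.mpr hq0)
  ext m
  rcases le_or_gt m d with hm | hm
  · exact (Polynomial.X_pow_dvd_iff.mp (key m hm)) m (Nat.lt_succ_self m)
  · exact Polynomial.coeff_eq_zero_of_natDegree_lt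
      ((natDegree_lineRestriction_le hf u v).trans_lt hm)

end LineContainment

section Rigidity

open MvPolynomial Matrix

variable {K : Type*} [Field K] {L : Type*} [Field L] [Algebra K L]

lemma exists_mul_sub_mul_ne_zero {u v : Fin 4 → L} (h : LinearIndependent L ![u, v]) :
    ∃ i j, u i * v j - u j * v i ≠ 0 := by
  by_contra! h0
  obtain ⟨j, hj⟩ := Function.ne_iff.mp (h.ne_zero 1)
  have := (LinearIndependent.pair_iff.mp h (v j) (-u j) (by
    ext i
    simpa [sub_eq_add_neg, mul_comm] using h0 i j)).1
  exact hj this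

/-- A nonzero linear form on the fourdimensional space has a zero which is not in the span of two
given vectors. -/
lemma exists_linearIndependent_triple_of_dotProduct_eq_zero (r : Fin 4 → L) {u v : Fin 4 → L}
    (h : LinearIndependent L ![u, v]) :
    ∃ x, r ⬝ᵥ x = 0 ∧ LinearIndependent L ![x, u, v] := by
  let φ : (Fin 4 → L) →ₗ[L] L := dotProductBilin L L r
  by_contra! h0
  have hle : LinearMap.ker φ ≤ Submodule.span L (Set.range ![u, v]) := by
    intro x hx
    by_contra hxs
    exact h0 x hx (linearIndependent_finCons.mpr ⟨h, hxs⟩)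
  have h1 := Submodule.finrank_mono hle
  have h2 := finrank_range_le_card (R := L) ![u, v]
  have h3 := φ.finrank_range_add_finrank_ker
  have h4 := Submodule.finrank_le (LinearMap.range φ)
  simp only [Module.finrank_fintype_fun_eq_card, Fintype.card_fin, Module.finrank_self] at h3 h4
  simp only [Set.finrank, Fintype.card_fin] at h2
  omega

lemma exists_forall_eq_comb {x u v : Fin 4 → L} (h : LinearIndependent L ![x, u, v]) :
    ∃ z : Fin 4 → L, ∀ w, ∃ a b c e : L, w = a • u + b • v + c • x + e • z := by
  have hz : ∃ z, z ∉ Submodule.span L (Set.range ![x, u, v]) := by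
    by_contra! h0
    have h1 : Submodule.span L (Set.range ![x, u, v]) = ⊤ := eq_top_iff.mpr fun z _ => h0 z
    have h2 := finrank_range_le_card (R := L) ![x, u, v]
    rw [Set.finrank, h1] at h2
    simp at h2
  obtain ⟨z, hz⟩ := hz
  have hli : LinearIndependent L ![z, x, u, v] := linearIndependent_finCons.mpr ⟨h, hz⟩
  refine ⟨z, fun w => ?_⟩
  have htop := hli.span_eq_top_of_card_eq_finrank (by simp)
  have hw : w ∈ Submodule.span L (Set.range ![z, x, u, v]) := htop ▸ Submodule.mem_top
  obtain ⟨c, hc⟩ := (Submodule.mem_span_range_iff_exists_fun L).mp hw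
  refine ⟨c 2, c 3, c 1, c 0, ?_⟩
  rw [← hc, Fin.sum_univ_four]
  simp only [cons_val]
  abel

lemma natDegree_le_one_of_mul_add_mul_eq_zero {a b : Polynomial L} (hab : IsCoprime a b) {s t : L}
    (h : a * (1 + Polynomial.C s * Polynomial.X) + Polynomial.C t * Polynomial.X * b = 0) :
    a.natDegree ≤ 1 ∧ b.natDegree ≤ 1 := by
  have hs : (1 + Polynomial.C s * Polynomial.X : Polynomial L) ≠ 0 := by
    intro h0
    simpa using congrArg (Polynomial.eval 0) h0
  constructor
  · by_cases ht : t = 0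
    · rw [ht] at h
      have : a = 0 := by simpa [hs] using h
      simp [this]
    · have hdvd : a ∣ Polynomial.C t * Polynomial.X :=
        hab.dvd_of_dvd_mul_right ⟨-(1 + Polynomial.C s * Polynomial.X), by linear_combination h⟩
      refine (Polynomial.natDegree_le_of_dvd hdvd ?_).trans (by compute_degree)
      simpa using ht
  · have hdvd : b ∣ 1 + Polynomial.C s * Polynomial.X :=
      hab.symm.dvd_of_dvd_mul_left ⟨-(Polynomial.C t * Polynomial.X), by linear_combination h⟩
    exact (Polynomial.natDegree_le_of_dvd hdvd hs).trans (by compute_degree)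

variable {f : MvPolynomial (Fin 4) K} {d : ℕ}

/-- A smooth surface does not contain a line through its generic point. -/
theorem IsGenericSurfacePoint.lineRestriction_ne_zero [IsAlgClosed K] (hd : 3 ≤ d)
    (hf : IsSmoothSurfaceOfDegree f d) {u v : Fin 4 → L} (hu : IsGenericSurfacePoint f u)
    (huv : LinearIndependent L ![u, v]) : lineRestriction f u v ≠ 0 := by
  intro h0
  obtain ⟨x, hx, hxuv⟩ := exists_linearIndependent_triple_of_dotProduct_eq_zero (gradAt f u) huv
  obtain ⟨z, hz⟩ := exists_forall_eq_comb hxuv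
  obtain ⟨D, hD⟩ := hu.exists_derivation x hx
  have hv0 : lineGrad f u v v = 0 := by
    rw [← derivative_lineRestriction_eq_lineGrad, h0, Polynomial.derivative_zero]
  have hu0 : lineGrad f u v u = 0 := by
    have := lineGrad_self_add hf.1 u v
    rwa [h0, hv0, mul_zero, mul_zero, add_zero] at this
  have hw : ∀ {w : Fin 4 → L} {a b c e : L}, w = a • u + b • v + c • x + e • z →
      lineGrad f u v w =
        Polynomial.C c * lineGrad f u v x + Polynomial.C e * lineGrad f u v z := by
    rintro _ a b c e rfl
    rw [lineGrad_add, lineGrad_add, lineGrad_add, lineGrad_smul, lineGrad_smul, lineGrad_smul,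
      lineGrad_smul, hu0, hv0, mul_zero, mul_zero, zero_add, zero_add]
  have hcop : IsCoprime (lineGrad f u v x) (lineGrad f u v z) := by
    let I := Ideal.span {lineGrad f u v x, lineGrad f u v z}
    have hle : Ideal.span (Set.range fun j => aeval
        (fun i => Polynomial.C (u i) + Polynomial.X * Polynomial.C (v i)) (pderiv j f)) ≤ I := by
      rw [Ideal.span_le]
      rintro _ ⟨j, rfl⟩
      obtain ⟨a, b, c, e, hj⟩ := hz (Pi.single j 1)
      have h := hw hj
      rw [lineGrad_single] at h
      exact Ideal.mem_span_pair.mpr ⟨_, _, h.symm⟩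
    have hm : ∀ i, Polynomial.C (u i) + Polynomial.X * Polynomial.C (v i) ∈ I.radical := fun i =>
      Ideal.radical_mono hle (mem_radical_span_aeval_pderiv hf _ i)
    obtain ⟨i, j, hij⟩ := exists_mul_sub_mul_ne_zero huv
    have hc : Polynomial.C (u i * v j - u j * v i) ∈ I.radical := by
      have := sub_mem (I.radical.mul_mem_left (Polynomial.C (v j)) (hm i))
        (I.radical.mul_mem_left (Polynomial.C (v i)) (hm j))
      convert this using 1
      simp only [map_sub, map_mul]
      ring
    have htop : I = ⊤ := Ideal.radical_eq_top.mp
      (Ideal.eq_top_of_isUnit_mem _ hc (Polynomial.isUnit_C.mpr hij.isUnit))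
    have h1 : (1 : Polynomial L) ∈ I := htop ▸ Submodule.mem_top
    exact Ideal.mem_span_pair.mp h1
  obtain ⟨E, hX, hC⟩ := exists_derivation_polynomial D
  have hE := derivation_lineRestriction hX hC f u v
  rw [h0, map_zero, show (fun i => D (u i)) = x from funext hD] at hE
  obtain ⟨a, b, c, e, hy⟩ := hz fun i => D (v i)
  rw [hw hy] at hE
  obtain ⟨hdx, hdz⟩ := natDegree_le_one_of_mul_add_mul_eq_zero (s := c) (t := e) hcop
    (by linear_combination -hE)
  refine gradAt_ne_zero hf (huv.ne_zero 1) ((dotProduct_eq_zero_iff).mp fun w => ?_)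
  obtain ⟨a, b, c, e, hw'⟩ := hz w
  change gradAt f v ⬝ᵥ w = 0
  rw [← coeff_lineGrad hf.1 u, hw hw', Polynomial.coeff_add, Polynomial.coeff_C_mul,
    Polynomial.coeff_C_mul, Polynomial.coeff_eq_zero_of_natDegree_lt (hdx.trans_lt (by omega)),
    Polynomial.coeff_eq_zero_of_natDegree_lt (hdz.trans_lt (by omega))]
  simp

end Rigidity

section Direction

open MvPolynomial Matrix

variable {K : Type*} [Field K] {L : Type*} [Field L] [Algebra K L]
  {f : MvPolynomial (Fin 4) K} {d : ℕ} {u : Fin 4 → L}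

lemma derivation_gradAt (D : Derivation K L L) (f : MvPolynomial (Fin 4) K) (u : Fin 4 → L)
    (i : Fin 4) : D (gradAt f u i) = (hessAt f u *ᵥ fun j => D (u j)) i := by
  rw [gradAt, derivation_aeval]
  simp only [mulVec, dotProduct, hessAt, of_apply, pderiv_comm_apply i]

lemma derivation_gradAt_dotProduct (D : Derivation K L L) (f : MvPolynomial (Fin 4) K)
    (u w : Fin 4 → L) :
    D (gradAt f u ⬝ᵥ w) =
      gradAt f u ⬝ᵥ (fun i => D (w i)) + w ⬝ᵥ hessAt f u *ᵥ fun i => D (u i) := by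
  rw [dotProduct, map_sum, dotProduct, dotProduct, ← Finset.sum_add_distrib]
  refine Finset.sum_congr rfl fun i _ => ?_
  rw [Derivation.leibniz, derivation_gradAt, smul_eq_mul, smul_eq_mul]

lemma derivation_hessAt (D : Derivation K L L) (f : MvPolynomial (Fin 4) K) (u : Fin 4 → L)
    (i j : Fin 4) : D (hessAt f u i j) = ∑ k, thirdAt f u i j k * D (u k) := by
  rw [hessAt, of_apply, derivation_aeval]
  refine Finset.sum_congr rfl fun k _ => ?_
  rw [thirdAt, pderiv_comm_apply j k, pderiv_comm_apply i k]

lemma derivation_dotProduct_hessAt_mulVec (D : Derivation K L L) (f : MvPolynomial (Fin 4) K)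
    (u x y : Fin 4 → L) :
    D (x ⬝ᵥ hessAt f u *ᵥ y) = (fun i => D (x i)) ⬝ᵥ hessAt f u *ᵥ y +
      x ⬝ᵥ hessAt f u *ᵥ (fun i => D (y i)) + trilin (thirdAt f u) x y (fun i => D (u i)) := by
  simp only [trilin, ← derivation_hessAt, dotProduct, mulVec, map_sum, Derivation.leibniz,
    smul_eq_mul, Finset.mul_sum, Finset.sum_mul, ← Finset.sum_add_distrib]
  refine Finset.sum_congr rfl fun i _ => ?_
  exact Finset.sum_congr rfl fun j _ => by ring

/-- There is a derivation moving the point `u` with velocity `v` and fixing the line spanned by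
`u` and `v`. -/
def IsStationaryDirection (K : Type*) [Field K] {L : Type*} [Field L] [Algebra K L]
    (u v : Fin 4 → L) : Prop :=
  LinearIndependent L ![u, v] ∧ ∃ (D : Derivation K L L) (a b : L),
    (∀ i, D (u i) = v i) ∧ (fun i => D (v i)) = a • u + b • v

lemma gradAt_dotProduct_eq_zero_iff (hf : f.IsHomogeneous d) (hd : ((d - 1 : ℕ) : L) ≠ 0)
    (x : Fin 4 → L) : gradAt f u ⬝ᵥ x = 0 ↔ u ⬝ᵥ hessAt f u *ᵥ x = 0 := by
  rw [dotProduct_mulVec_symm (hessAt_isSymm f u), hessAt_mulVec_self hf, dotProduct_smul,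
    smul_eq_mul, mul_eq_zero, or_iff_right hd, dotProduct_comm]

lemma IsGenericSurfacePoint.exists_isStationaryDirection_of_det_ne_zero
    (hf : f.IsHomogeneous d) (hu : IsGenericSurfacePoint f u) (hd : ((d - 1 : ℕ) : L) ≠ 0)
    (h2 : (2 : L) ≠ 0) (hsq : ∀ x : L, ∃ z, x = z * z) (hdet : (hessAt f u).det ≠ 0)
    (h : flecForm (hessAt f u).adjugate (thirdAt f u) = 0) :
    ∃ v, IsStationaryDirection K u v := by
  have hs := dotProduct_mulVec_symm (hessAt_isSymm f u)
  have huu : u ⬝ᵥ hessAt f u *ᵥ u = 0 := by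
    rw [← gradAt_dotProduct_eq_zero_iff hf hd, gradAt_dotProduct_self hf,
      hu.aeval_eq_zero f dvd_rfl, mul_zero]
  obtain ⟨P, hP, hP0⟩ := exists_isHyperbolicBasis h2 hsq (hessAt_isSymm f u) hdet hu.ne_zero huu
  have hP0C : ∀ y z, trilin (thirdAt f u) (P 0) y z =
      ((d - 2 : ℕ) : L) * (y ⬝ᵥ hessAt f u *ᵥ z) := by
    rw [hP0]
    exact trilin_thirdAt_self hf u
  rw [hP.flecForm_adjugate (thirdAt_left_comm f u) (thirdAt_right_comm f u) hP0C] at h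
  have h8 : (8 : L) ≠ 0 := by
    rw [show (8 : L) = 2 ^ 3 by norm_num]
    exact pow_ne_zero _ h2
  have hc : ∃ i, (i = 2 ∨ i = 3) ∧ trilin (thirdAt f u) (P i) (P i) (P i) = 0 := by
    rcases mul_eq_zero.mp ((mul_eq_zero.mp ((mul_eq_zero.mp h).resolve_left
      (pow_ne_zero _ hdet))).resolve_left h8) with h | h
    · exact ⟨2, Or.inl rfl, h⟩
    · exact ⟨3, Or.inr rfl, h⟩
  obtain ⟨i, hi, hc⟩ := hc
  have hdir := hP.isFlecnodalDirection hi hc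
  have htan := hdir.tangent
  rw [hP0, ← gradAt_dotProduct_eq_zero_iff hf hd] at htan
  obtain ⟨D, hD⟩ := hu.exists_derivation (P i) htan
  have hDu : (fun i => D (u i)) = P i := funext hD
  have h1 := derivation_gradAt_dotProduct D f u (P i)
  rw [htan, map_zero, hDu, hdir.asymptotic, add_zero, eq_comm,
    gradAt_dotProduct_eq_zero_iff hf hd] at h1
  have h3 := derivation_dotProduct_hessAt_mulVec D f u (P i) (P i)
  rw [hdir.asymptotic, map_zero, hDu, hdir.cubic, add_zero, hs, ← two_mul, eq_comm, mul_eq_zero,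
    or_iff_right h2] at h3
  refine ⟨P i, hP0 ▸ hdir.linearIndependent, D, ?_⟩
  have e := hP.eq_sum fun j => D (P i j)
  rw [hP0, h1, zero_smul, add_zero] at e
  rcases hi with rfl | rfl
  · rw [h3, zero_smul, add_zero] at e
    exact ⟨_, _, hD, e⟩
  · rw [h3, zero_smul, add_zero] at e
    exact ⟨_, _, hD, e⟩

lemma IsGenericSurfacePoint.exists_isStationaryDirection_of_adjugate_ne_zero
    (hf : f.IsHomogeneous d) (hu : IsGenericSurfacePoint f u) (hd : ((d - 1 : ℕ) : L) ≠ 0)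
    (hg : gradAt f u ≠ 0) (hdet : (hessAt f u).det = 0) (hadj : (hessAt f u).adjugate ≠ 0) :
    ∃ v, IsStationaryDirection K u v := by
  obtain ⟨k, -, hk0, -, hk, hker, -⟩ :=
    exists_ker_eq_span_of_adjugate_ne_zero (hessAt_isSymm f u) hdet hadj
  have hAu : hessAt f u *ᵥ u ≠ 0 := by
    rw [hessAt_mulVec_self hf]
    exact smul_ne_zero hd hg
  have hD : ∀ (D : Derivation K L L) (y : Fin 4 → L), y ⬝ᵥ hessAt f u *ᵥ (fun i => D (k i)) +
      trilin (thirdAt f u) y k (fun i => D (u i)) = 0 := by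
    intro D y
    have := derivation_dotProduct_hessAt_mulVec D f u y k
    rwa [hk, dotProduct_zero, dotProduct_zero, map_zero, zero_add, eq_comm] at this
  have hC : ∀ x, gradAt f u ⬝ᵥ x = 0 → trilin (thirdAt f u) k k x = 0 := by
    intro x hx
    obtain ⟨D, hDx⟩ := hu.exists_derivation x hx
    have := hD D k
    rwa [dotProduct_mulVec_symm (hessAt_isSymm f u), hk, dotProduct_zero, zero_add,
      show (fun i => D (u i)) = x from funext hDx] at this
  obtain ⟨i, hi⟩ := Function.ne_iff.mp hg
  have hC' : ∀ y, trilin (thirdAt f u) y k k = gradAt f u ⬝ᵥ y *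
      ((gradAt f u i)⁻¹ * trilin (thirdAt f u) k k (Pi.single i 1)) := by
    intro y
    have h := hC (y + (-(gradAt f u ⬝ᵥ y * (gradAt f u i)⁻¹)) • Pi.single i 1) (by
      rw [dotProduct_add, dotProduct_smul, dotProduct_single_one, smul_eq_mul, neg_mul,
        inv_mul_cancel_right₀ hi, add_neg_cancel])
    rw [trilin_add_right, trilin_smul_right] at h
    rw [trilin_left_comm (thirdAt_left_comm f u), trilin_right_comm (thirdAt_right_comm f u)]
    linear_combination h
  have hkg : gradAt f u ⬝ᵥ k = 0 := by
    rw [gradAt_dotProduct_eq_zero_iff hf hd, hk, dotProduct_zero]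
  obtain ⟨D, hDk⟩ := hu.exists_derivation k hkg
  set t := (gradAt f u i)⁻¹ * trilin (thirdAt f u) k k (Pi.single i 1)
  obtain ⟨s, hs⟩ := hker ((fun i => D (k i)) + (((d - 1 : ℕ) : L)⁻¹ * t) • u) (by
    refine dotProduct_eq_zero _ fun y => ?_
    have h := hD D y
    rw [show (fun i => D (u i)) = k from funext hDk, hC'] at h
    rw [dotProduct_comm, mulVec_add, mulVec_smul, hessAt_mulVec_self hf, smul_smul, mul_right_comm,
      inv_mul_cancel₀ hd, one_mul, dotProduct_add, dotProduct_smul, smul_eq_mul,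
      dotProduct_comm y (gradAt f u)]
    linear_combination h)
  refine ⟨k, linearIndependent_of_mulVec_eq_zero hAu hk0 hk, D,
    -(((d - 1 : ℕ) : L)⁻¹ * t), s, hDk, ?_⟩
  rw [neg_smul, neg_add_eq_sub, ← hs, add_sub_cancel_right]

lemma IsGenericSurfacePoint.exists_isStationaryDirection_of_adjugate_eq_zero
    (hf : f.IsHomogeneous d) (hu : IsGenericSurfacePoint f u) (hd : ((d - 1 : ℕ) : L) ≠ 0)
    (hg : gradAt f u ≠ 0) (hadj : (hessAt f u).adjugate = 0) :
    ∃ v, IsStationaryDirection K u v := by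
  have hguu : gradAt f u ⬝ᵥ u = 0 := by
    rw [gradAt_dotProduct_self hf, hu.aeval_eq_zero f dvd_rfl, mul_zero]
  have hAu : hessAt f u *ᵥ u ≠ 0 := by
    rw [hessAt_mulVec_self hf]
    exact smul_ne_zero hd hg
  obtain ⟨m, hm⟩ := Function.ne_iff.mp hu.ne_zero
  obtain ⟨i, him, hi⟩ : ∃ i, i ≠ m ∧ gradAt f u i ≠ 0 := by
    by_contra! h
    have hgm : gradAt f u m = 0 := by
      rw [dotProduct, Finset.sum_eq_single m (fun b _ hb => by rw [h b hb, zero_mul])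
        (fun h => absurd (Finset.mem_univ m) h)] at hguu
      exact (mul_eq_zero.mp hguu).resolve_right hm
    refine hg (funext fun b => ?_)
    by_cases hb : b = m
    · rw [hb, hgm, Pi.zero_apply]
    · exact h b hb
  obtain ⟨j, hji, hjm⟩ : ∃ j, j ≠ i ∧ j ≠ m := by
    have : ∀ i m : Fin 4, ∃ j, j ≠ i ∧ j ≠ m := by decide
    exact this i m
  let v : Fin 4 → L := gradAt f u i • Pi.single j 1 - gradAt f u j • Pi.single i 1
  have hgv : gradAt f u ⬝ᵥ v = 0 := by
    simp only [v, dotProduct_sub, dotProduct_smul, dotProduct_single_one, smul_eq_mul]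
    ring
  have hvv : v ⬝ᵥ hessAt f u *ᵥ v = 0 :=
    dotProduct_mulVec_self_eq_zero_of_adjugate_eq_zero (hessAt_isSymm f u) hadj hAu
      ((gradAt_dotProduct_eq_zero_iff hf hd u).mp hguu)
      ((gradAt_dotProduct_eq_zero_iff hf hd v).mp hgv)
  have hvj : v j = gradAt f u i := by simp [v, hji]
  have hvm : v m = 0 := by simp [v, hjm.symm, him.symm]
  obtain ⟨D, hD⟩ := hu.exists_derivation v hgv
  have hDv : (fun l => D (v l)) =
      D (gradAt f u i) • Pi.single j 1 - D (gradAt f u j) • Pi.single i 1 := by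
    ext l
    simp only [v, Pi.sub_apply, Pi.smul_apply, smul_eq_mul, map_sub, Pi.single_apply]
    split_ifs <;> simp
  have h := derivation_gradAt_dotProduct D f u v
  rw [hgv, map_zero, show (fun i => D (u i)) = v from funext hD, hvv, add_zero, hDv, dotProduct_sub,
    dotProduct_smul, dotProduct_smul, dotProduct_single_one, dotProduct_single_one, smul_eq_mul,
    smul_eq_mul] at h
  refine ⟨v, ?_, D, 0, D (gradAt f u i) * (gradAt f u i)⁻¹, hD, ?_⟩
  · rw [LinearIndependent.pair_iff]
    intro s t hst
    have hs : s = 0 := by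
      have := congrFun hst m
      rw [Pi.add_apply, Pi.smul_apply, Pi.smul_apply, hvm, smul_zero, add_zero, smul_eq_mul] at this
      exact (mul_eq_zero.mp this).resolve_right hm
    refine ⟨hs, ?_⟩
    have := congrFun hst j
    rw [hs, zero_smul, zero_add, Pi.smul_apply, hvj, smul_eq_mul] at this
    exact (mul_eq_zero.mp this).resolve_right hi
  · have hj : D (gradAt f u j) = D (gradAt f u i) * (gradAt f u i)⁻¹ * gradAt f u j := by
      field_simp
      linear_combination h
    rw [hDv, zero_smul, zero_add, smul_sub, smul_smul, smul_smul, inv_mul_cancel_right₀ hi, ← hj]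

theorem not_dvd_flecPoly {K : Type*} [Field K] [IsAlgClosed K] {d : ℕ} (hd : 3 ≤ d)
    (hchar : ringChar K = 0 ∨ d < ringChar K) {f : MvPolynomial (Fin 4) K}
    (hf : IsSmoothSurfaceOfDegree f d) : ¬ f ∣ flecPoly f := by
  intro hdvd
  obtain ⟨L, _, _, _, u, hu⟩ := exists_isGenericSurfacePoint (by omega) hf
  have hcast : ∀ m : ℕ, m ≠ 0 → m ≤ d → (m : L) ≠ 0 := by
    intro m hm hmd h0
    refine natCast_ne_zero_of_ringChar hchar hm hmd ((algebraMap K L).injective ?_)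
    rwa [map_natCast, map_zero]
  have h2 : (2 : L) ≠ 0 := mod_cast hcast 2 (by omega) (by omega)
  have hd1 := hcast (d - 1) (by omega) (by omega)
  have hg := gradAt_ne_zero hf hu.ne_zero
  have : NeZero (2 : L) := ⟨h2⟩
  obtain ⟨v, huv, D, a, b, hDu, hDv⟩ : ∃ v, IsStationaryDirection K u v := by
    by_cases hdet : (hessAt f u).det = 0
    · by_cases hadj : (hessAt f u).adjugate = 0
      · exact hu.exists_isStationaryDirection_of_adjugate_eq_zero hf.1 hd1 hg hadj
      · exact hu.exists_isStationaryDirection_of_adjugate_ne_zero hf.1 hd1 hg hdet hadj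
    · refine hu.exists_isStationaryDirection_of_det_ne_zero hf.1 hd1 h2
        (fun x => IsSepClosed.exists_eq_mul_self x) hdet ?_
      rw [← aeval_flecPoly]
      exact hu.aeval_eq_zero _ hdvd
  exact hu.lineRestriction_ne_zero hd hf huv
    (lineRestriction_eq_zero_of_derivation hf.1 hcast (hu.aeval_eq_zero f dvd_rfl) D hDu
      fun i => congrFun hDv i)

end Direction

theorem flecnodal_polynomial_exists
    {K : Type*} [Field K] [IsAlgClosed K] (d : ℕ) (hd : 3 ≤ d)
    (hchar : ringChar K = 0 ∨ d < ringChar K)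
    (f : MvPolynomial (Fin 4) K) (hf : IsSmoothSurfaceOfDegree f d) :
    ∃ g : MvPolynomial (Fin 4) K, g.IsHomogeneous (11 * d - 24) ∧ ¬ f ∣ g ∧
      ∀ u : Fin 4 → K, u ≠ 0 → MvPolynomial.eval u f = 0 →
        (MvPolynomial.eval u g = 0 ↔
          ∃ v : Fin 4 → K, LinearIndependent K ![u, v] ∧ ordGE f u v 4) := by
  exact ⟨flecPoly f, isHomogeneous_flecPoly hd hf.1, not_dvd_flecPoly hd hchar hf,
    fun u hu hfu => eval_flecPoly_eq_zero_iff hd hchar hf hu hfu⟩
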